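/- Let A_S be an Artin-Tits group of large type, and let w and w' be two geodesic words over S ∪ S⁻¹ representing the same element of A_S. Then w' →_{1,2} w, i.e. w' can be transformed into w by a finite sequence of transformations of types 1 and 2. -/

import Mathlib

namespace ArtinTits

open Classical List

variable {S : Type*}

/-- A word over `S ∪ S⁻¹`: a list of letters, each a generator together with a sign
(`true` = the generator itself, `false` = its formal inverse). -/
abbrev Word (S : Type*) := List (S × Bool)

/-- The formal inverse of a word. -/
def wordInv (w : Word S) : Word S := w.reverse.map fun l => (l.1, !l.2)

/-- `[x,y,j⟩`: the alternating positive word `xyxy⋯` with `j` letters, beginning with `x`. -/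
def altWord (x y : S) : ℕ → Word S
  | 0 => []
  | j + 1 => (x, true) :: altWord y x j

/-- `⟨x,y,j]`: the alternating positive word `⋯xy` with `j` letters, ending with `y`. -/
def altWordR (x y : S) (j : ℕ) : Word S := (altWord y x j).reverse

/-- The data of a labelled finite complete simplicial graph `Γ₀`: a symmetric label map
with values in `{2,3,…} ∪ {∞}` on pairs of distinct vertices. -/
structure ArtinData (S : Type*) where
  m : S → S → ℕ∞
  symm : ∀ s t, m s t = m t s
  two_le : ∀ s t : S, s ≠ t → 2 ≤ m s t

/-- `u = v` is a defining (braid) relation of the Artin–Tits presentation. -/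
def IsRel (A : ArtinData S) (u v : Word S) : Prop :=
  ∃ (s t : S) (k : ℕ), s ≠ t ∧ A.m s t = (k : ℕ∞) ∧
    u = altWord s t k ∧ v = altWord t s k

/-- The relator set of the Artin–Tits presentation, inside the free group. -/
def rels (A : ArtinData S) : Set (FreeGroup S) :=
  {x | ∃ u v : Word S, IsRel A u v ∧ x = FreeGroup.mk u * (FreeGroup.mk v)⁻¹}

/-- The Artin–Tits group `A(Γ₀)` of the presentation. -/
abbrev ArtinGroup (A : ArtinData S) := PresentedGroup (rels A)

/-- `w̄`: the element of the Artin–Tits group represented by the word `w`. -/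
def wbar (A : ArtinData S) (w : Word S) : ArtinGroup A :=
  PresentedGroup.mk (rels A) (FreeGroup.mk w)

/-! ### Special transformations -/

/-- Type 0: delete a factor `s s⁻¹` or `s⁻¹ s`. -/
def Step0 (w w' : Word S) : Prop :=
  ∃ (w₁ w₂ : Word S) (s : S) (b : Bool),
    w = w₁ ++ [(s, b), (s, !b)] ++ w₂ ∧ w' = w₁ ++ w₂

/-- Type ∞: insert a factor `s s⁻¹` or `s⁻¹ s` (the inverse of type 0). -/
def StepInfty (w w' : Word S) : Prop := Step0 w' w

/-- Type 1: replace a factor `v` by `u`, or `v⁻¹` by `u⁻¹`, where `u = v` is a defining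
relation. -/
def Step1 (A : ArtinData S) (w w' : Word S) : Prop :=
  ∃ (w₁ w₂ u v : Word S), IsRel A u v ∧
    ((w = w₁ ++ v ++ w₂ ∧ w' = w₁ ++ u ++ w₂) ∨
     (w = w₁ ++ wordInv v ++ w₂ ∧ w' = w₁ ++ wordInv u ++ w₂))

/-- Type 2r: for a defining relation `u₁u₂ = v₁v₂` with `u₁, v₁` non-empty, replace a factor
`v₁⁻¹ u₁` by `v₂ u₂⁻¹`. -/
def Step2r (A : ArtinData S) (w w' : Word S) : Prop :=
  ∃ (w₁ w₂ u₁ u₂ v₁ v₂ : Word S), IsRel A (u₁ ++ u₂) (v₁ ++ v₂) ∧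
    u₁ ≠ [] ∧ v₁ ≠ [] ∧
    w = w₁ ++ wordInv v₁ ++ u₁ ++ w₂ ∧ w' = w₁ ++ v₂ ++ wordInv u₂ ++ w₂

/-- Type 2l: for a defining relation `u₁u₂ = v₁v₂` with `u₂, v₂` non-empty, replace a factor
`v₂ u₂⁻¹` by `v₁⁻¹ u₁`. -/
def Step2l (A : ArtinData S) (w w' : Word S) : Prop :=
  ∃ (w₁ w₂ u₁ u₂ v₁ v₂ : Word S), IsRel A (u₁ ++ u₂) (v₁ ++ v₂) ∧
    u₂ ≠ [] ∧ v₂ ≠ [] ∧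
    w = w₁ ++ v₂ ++ wordInv u₂ ++ w₂ ∧ w' = w₁ ++ wordInv v₁ ++ u₁ ++ w₂

/-- Type 2: a type 2r or type 2l transformation. -/
def Step2 (A : ArtinData S) (w w' : Word S) : Prop := Step2r A w w' ∨ Step2l A w w'

/-- `p` is the greatest (longest) common left factor of `x` and `y`. -/
def IsLCPrefix (p x y : Word S) : Prop :=
  p <+: x ∧ p <+: y ∧ ∀ q : Word S, q <+: x → q <+: y → q.length ≤ p.length

/-- `p` is the greatest (longest) common right factor of `x` and `y`. -/
def IsLCSuffix (p x y : Word S) : Prop :=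
  p <:+ x ∧ p <:+ y ∧ ∀ q : Word S, q <:+ x → q <:+ y → q.length ≤ p.length

/-- Type 2r⋆ : a type 2r transformation `w₁ v⁻¹ v' w₂ → w₁ u (u')⁻¹ w₂` (with `vu = v'u'` a
defining relation) such that `v` is the greatest common left factor of `vu` and `v w₁⁻¹`, and
`v'` is the greatest common left factor of `v'u'` and `v' w₂`. -/
def Step2rStar (A : ArtinData S) (w w' : Word S) : Prop :=
  ∃ (w₁ w₂ v u v' u' : Word S), IsRel A (v ++ u) (v' ++ u') ∧
    v ≠ [] ∧ v' ≠ [] ∧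
    w = w₁ ++ wordInv v ++ v' ++ w₂ ∧
    w' = w₁ ++ u ++ wordInv u' ++ w₂ ∧
    IsLCPrefix v (v ++ u) (v ++ wordInv w₁) ∧
    IsLCPrefix v' (v' ++ u') (v' ++ w₂)

/-- Type 2l⋆ : a type 2l transformation `w₁ v (v')⁻¹ w₂ → w₁ u⁻¹ u' w₂` (with `uv = u'v'` a
defining relation) such that `v` is the greatest common right factor of `uv` and `w₁ v`, and
`v'` is the greatest common right factor of `u'v'` and `w₂⁻¹ v'`. -/
def Step2lStar (A : ArtinData S) (w w' : Word S) : Prop :=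
  ∃ (w₁ w₂ v u v' u' : Word S), IsRel A (u ++ v) (u' ++ v') ∧
    v ≠ [] ∧ v' ≠ [] ∧
    w = w₁ ++ v ++ wordInv v' ++ w₂ ∧
    w' = w₁ ++ wordInv u ++ u' ++ w₂ ∧
    IsLCSuffix v (u ++ v) (w₁ ++ v) ∧
    IsLCSuffix v' (u' ++ v') (wordInv w₂ ++ v')

/-- Type 2⋆ : a type 2r⋆ or type 2l⋆ transformation. -/
def Step2Star (A : ArtinData S) (w w' : Word S) : Prop :=
  Step2rStar A w w' ∨ Step2lStar A w w'

/-- `w →_{0,1,2} w'`. -/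
def Steps012 (A : ArtinData S) : Word S → Word S → Prop :=
  Relation.ReflTransGen fun x y => Step0 x y ∨ Step1 A x y ∨ Step2 A x y

/-- `w →_{0,1,2⋆} w'`. -/
def Steps012Star (A : ArtinData S) : Word S → Word S → Prop :=
  Relation.ReflTransGen fun x y => Step0 x y ∨ Step1 A x y ∨ Step2Star A x y

/-- `w →_{2⋆} w'`. -/
def Steps2Star (A : ArtinData S) : Word S → Word S → Prop :=
  Relation.ReflTransGen (Step2Star A)

/-- `w →_{1,2⋆} w'`. -/
def Steps12Star (A : ArtinData S) : Word S → Word S → Prop :=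
  Relation.ReflTransGen fun x y => Step1 A x y ∨ Step2Star A x y

/-- `w →_{1,2} w'`. -/
def Steps12 (A : ArtinData S) : Word S → Word S → Prop :=
  Relation.ReflTransGen fun x y => Step1 A x y ∨ Step2 A x y

/-! ### Classes of words -/

/-- A positive word: written over `S`. -/
def Positive (w : Word S) : Prop := ∀ l ∈ w, l.2 = true

/-- A negative word: written over `S⁻¹`. -/
def Negative (w : Word S) : Prop := ∀ l ∈ w, l.2 = false

/-- A signed word: positive or negative. -/
def Signed (w : Word S) : Prop := Positive w ∨ Negative w

/-- An unsigned word: neither positive nor negative. -/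
def Unsigned (w : Word S) : Prop := ¬ Positive w ∧ ¬ Negative w

/-- A freely reduced word: no factor `s s⁻¹` or `s⁻¹ s`. -/
def FreelyReduced (w : Word S) : Prop :=
  ∀ (w₁ w₂ : Word S) (s : S) (b : Bool), w ≠ w₁ ++ [(s, b), (s, !b)] ++ w₂

/-- A square-free word: no factor `aa`. -/
def SquareFree (w : Word S) : Prop := ∀ a : S × Bool, ¬ [a, a] <:+: w

/-- `p̃(w)`: the length of the longest square-free positive factor of `w`. -/
noncomputable def ptilde (w : Word S) : ℕ :=
  sSup {n | ∃ v : Word S, v <:+: w ∧ Positive v ∧ SquareFree v ∧ v.length = n}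

/-- `ñ(w)`: the length of the longest negative factor of `w` whose formal inverse is
square-free. -/
noncomputable def ntilde (w : Word S) : ℕ :=
  sSup {n | ∃ v : Word S, v <:+: w ∧ Negative v ∧ SquareFree (wordInv v) ∧ v.length = n}

/-- `p(w) = min(p̃(w), m)`. -/
noncomputable def pfun (M : ℕ) (w : Word S) : ℕ := min (ptilde w) M

/-- `n(w) = min(ñ(w), m)`. -/
noncomputable def nfun (M : ℕ) (w : Word S) : ℕ := min (ntilde w) M

/-- `Ω(Γ₀)` (for a dihedral presentation with label `M`): the freely reduced words with
`max(p(w), n(w)) < M`. -/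
def Omega (M : ℕ) (w : Word S) : Prop :=
  FreelyReduced w ∧ max (pfun M w) (nfun M w) < M

/-- A signed square-free word (square-free positive, or negative with square-free inverse). -/
def SignedSF (w : Word S) : Prop :=
  (Positive w ∧ SquareFree w) ∨ (Negative w ∧ SquareFree (wordInv w))

/-- `v` is the maximal square-free signed left factor of `w`. -/
def MaxSignedSFPrefix (v w : Word S) : Prop :=
  v <+: w ∧ SignedSF v ∧ ∀ v' : Word S, v' <+: w → SignedSF v' → v'.length ≤ v.length

/-- `(v₁, …, v_k)` is the `⋆`-decomposition of `w`: the `v_i` are non-empty, `w = v₁⋯v_k`,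
and each `v_i` is the maximal square-free signed left factor of `v_i⋯v_k`. -/
def StarDecomp (w : Word S) (L : List (Word S)) : Prop :=
  w = L.flatten ∧ (∀ v ∈ L, v ≠ ([] : Word S)) ∧
    ∀ i (h : i < L.length), MaxSignedSFPrefix (L.get ⟨i, h⟩) ((L.drop i).flatten)

/-! ### Groups, parabolic subgroups, geodesics -/

/-- A word written over `T ∪ T⁻¹` for a subset `T` of the generators. -/
def WordOver (T : Set S) (w : Word S) : Prop := ∀ l ∈ w, l.1 ∈ T

/-- The standard parabolic subgroup `A_T` generated by the image of `T ⊆ S`. -/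
def parab (A : ArtinData S) (T : Set S) : Subgroup (ArtinGroup A) :=
  Subgroup.closure {x | ∃ s ∈ T, x = wbar A [(s, true)]}

/-- A geodesic word: of minimal length among all words representing the same element. -/
def Geodesic (A : ArtinData S) (w : Word S) : Prop :=
  ∀ w' : Word S, wbar A w' = wbar A w → w.length ≤ w'.length

/-- A word over `T ∪ T⁻¹` that is geodesic among the words over `T ∪ T⁻¹` representing the
same element. -/
def GeodesicOver (A : ArtinData S) (T : Set S) (w : Word S) : Prop :=
  WordOver T w ∧
    ∀ w' : Word S, WordOver T w' → wbar A w' = wbar A w → w.length ≤ w'.length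

/-- The length of a group element: the length of any geodesic representative word. -/
noncomputable def elLength (A : ArtinData S) (g : ArtinGroup A) : ℕ :=
  sInf {n | ∃ w : Word S, wbar A w = g ∧ w.length = n}

/-- A positive element: one represented by a positive word. -/
def IsPosElt (A : ArtinData S) (g : ArtinGroup A) : Prop :=
  ∃ w : Word S, Positive w ∧ wbar A w = g

/-- An `H`-transversal: a subset containing `1` and exactly one element of each left
`H`-coset. -/
def IsLeftTransversal {G : Type*} [Group G] (H : Subgroup G) (T : Set G) : Prop :=
  (1 : G) ∈ T ∧ ∀ g : G, ∃! x, x ∈ T ∧ g⁻¹ * x ∈ H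

/-! ### Properties H, H⁺, H# -/

/-- Property `H`: `w →_{0,1,2} ε ↔ w̄ = 1`. -/
def PropertyH (A : ArtinData S) : Prop :=
  ∀ w : Word S, Steps012 A w [] ↔ wbar A w = 1

/-- Property `H⁺`: every word representing an element of a standard parabolic subgroup
`A_{S₀}` can be transformed by `→_{0,1,2⋆}` into a word over `S₀ ∪ S₀⁻¹`. -/
def PropertyHPlus (A : ArtinData S) : Prop :=
  ∀ (S₀ : Set S) (w : Word S), wbar A w ∈ parab A S₀ →
    ∃ w₀ : Word S, WordOver S₀ w₀ ∧ Steps012Star A w w₀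

/-- Property `H#` with respect to an `S`-sequence of transversals `T`. -/
def PropertyHSharpWrt (A : ArtinData S) (T : Set S → Set (ArtinGroup A)) : Prop :=
  (∀ S₀ : Set S, IsLeftTransversal (parab A S₀) (T S₀)) ∧
    ∀ (S' S₀ : Set S) (w : Word S), wbar A w ∈ parab A S' →
      ∃ v u : Word S, WordOver S' v ∧ WordOver (S' ∩ S₀) u ∧
        Steps012 A w (v ++ u) ∧ wbar A v ∈ T S₀

/-- Property `H#`: property `H#` with respect to some `S`-sequence of transversals. -/
def PropertyHSharp (A : ArtinData S) : Prop :=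
  ∃ T : Set S → Set (ArtinGroup A), PropertyHSharpWrt A T

/-! ### Critical words and the involution τ (relative to a dihedral pair) -/

/-- The permutation `δ` induced by conjugation by `Δ`, extended letterwise to words:
the identity if `M` is even, and the swap of `s` and `t` if `M` is odd. -/
noncomputable def deltaMap (s t : S) (M : ℕ) (w : Word S) : Word S :=
  if Even M then w
  else w.map fun l => (if l.1 = s then t else if l.1 = t then s else l.1, l.2)

/-- `w` is an unsigned critical word (of the dihedral pair `{s,t}` with label `M`) and
`w' = τ(w)`. -/
def UCritTauPair (A : ArtinData S) (s t : S) (M : ℕ) (w w' : Word S) : Prop :=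
  WordOver {s, t} w ∧ FreelyReduced w ∧ Unsigned w ∧ GeodesicOver A {s, t} w ∧
  pfun M w + nfun M w = M ∧
  ∃ (x y z z' : S) (wm : Word S),
    ({x, y} : Set S) = {s, t} ∧ ({z, z'} : Set S) = {s, t} ∧
    ((w = altWord x y (pfun M w) ++ wm ++ wordInv (altWord z z' (nfun M w)) ∧
      w' = wordInv (altWordR x y (nfun M w)) ++ deltaMap s t M wm ++
        altWordR z z' (pfun M w)) ∨
     (w = wordInv (altWordR x y (nfun M w)) ++ wm ++ altWordR z z' (pfun M w) ∧
      w' = altWord x y (pfun M w) ++ deltaMap s t M wm ++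
        wordInv (altWord z z' (nfun M w))))

/-- `w` is a positive critical word (of the dihedral pair `{s,t}` with label `M`) and
`w' = τ(w)`. -/
def PosCritTauPair (A : ArtinData S) (s t : S) (M : ℕ) (w w' : Word S) : Prop :=
  WordOver {s, t} w ∧ Positive w ∧ pfun M w = M ∧
  ∃ (x y : S) (wm : Word S), ({x, y} : Set S) = {s, t} ∧ pfun M wm < M ∧
    ((w = altWord x y M ++ wm ∧
      (w' = deltaMap s t M wm ++ altWordR x y M ∨
       w' = deltaMap s t M wm ++ altWordR y x M) ∧
      w'.getLast? ≠ w.getLast?) ∨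
     (w = wm ++ altWordR x y M ∧
      (w' = altWord x y M ++ deltaMap s t M wm ∨
       w' = altWord y x M ++ deltaMap s t M wm) ∧
      w'.head? ≠ w.head?))

/-- `w` is a negative critical word and `w' = τ(w)` (defined via formal inverses). -/
def NegCritTauPair (A : ArtinData S) (s t : S) (M : ℕ) (w w' : Word S) : Prop :=
  PosCritTauPair A s t M (wordInv w) (wordInv w')

/-- `w` is a critical word (unsigned, positive or negative) and `w' = τ(w)`. -/
def CritTauPair (A : ArtinData S) (s t : S) (M : ℕ) (w w' : Word S) : Prop :=
  UCritTauPair A s t M w w' ∨ PosCritTauPair A s t M w w' ∨ NegCritTauPair A s t M w w'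

/-- A type β transformation relative to the dihedral pair `{s,t}` with label `M`:
replace a critical factor `v` by `τ(v)`. -/
def StepBetaPair (A : ArtinData S) (s t : S) (M : ℕ) (w w' : Word S) : Prop :=
  ∃ (w₁ w₂ v v' : Word S), w = w₁ ++ v ++ w₂ ∧ w' = w₁ ++ v' ++ w₂ ∧
    CritTauPair A s t M v v'

/-- A type β transformation (in an Artin–Tits group): a type β transformation relative to some
dihedral standard parabolic subgroup (a pair of generators with finite label). -/
def StepBeta (A : ArtinData S) (w w' : Word S) : Prop :=
  ∃ (s t : S) (M : ℕ), s ≠ t ∧ A.m s t = (M : ℕ∞) ∧ StepBetaPair A s t M w w'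

/-! ### Restriction, direct products, Coxeter graph notions -/

/-- The Artin–Tits presentation induced on a subset `T` of the generators (the presentation of
the standard parabolic subgroup `A_T`). -/
def ArtinData.restrict (A : ArtinData S) (T : Set S) : ArtinData T where
  m a b := A.m a b
  symm a b := A.symm a b
  two_le a b h := A.two_le a b fun h' => h (Subtype.ext h')

/-- The Artin–Tits presentation on the disjoint union `S₁ ⊕ S₂` obtained from presentations on
`S₁` and `S₂` by adding the commuting relations `s₁s₂ = s₂s₁` (label `2`) for `s₁ ∈ S₁`,
`s₂ ∈ S₂`. -/
def prodData {S₁ S₂ : Type*} (A₁ : ArtinData S₁) (A₂ : ArtinData S₂) :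
    ArtinData (S₁ ⊕ S₂) where
  m x y :=
    match x, y with
    | Sum.inl a, Sum.inl b => A₁.m a b
    | Sum.inr a, Sum.inr b => A₂.m a b
    | _, _ => 2
  symm x y := by
    cases x <;> cases y
    · exact A₁.symm _ _
    · rfl
    · rfl
    · exact A₂.symm _ _
  two_le x y h := by
    cases x <;> cases y
    · exact A₁.two_le _ _ fun h' => h (congrArg Sum.inl h')
    · exact le_rfl
    · exact le_rfl
    · exact A₂.two_le _ _ fun h' => h (congrArg Sum.inr h')

/-- Adjacency in the Coxeter graph `Γ` restricted to `T`: distinct vertices of `T` joined by an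
edge (i.e. with label `≠ 2`, edges labelled `2` being removed in `Γ`). -/
def coxAdj (A : ArtinData S) (T : Set S) (x y : S) : Prop :=
  x ∈ T ∧ y ∈ T ∧ x ≠ y ∧ A.m x y ≠ 2

/-- The full subgraph of the Coxeter graph on the vertex subset `T` is connected. -/
def CoxConnected (A : ArtinData S) (T : Set S) : Prop :=
  ∀ x ∈ T, ∀ y ∈ T, Relation.ReflTransGen (coxAdj A T) x y

/-- The relator set of the Coxeter presentation on `T`: the Artin relations together with the
squares of the generators. -/
def coxRels (A : ArtinData S) (T : Set S) : Set (FreeGroup T) :=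
  rels (A.restrict T) ∪ {g | ∃ x : T, g = FreeGroup.of x * FreeGroup.of x}

/-- The induced presentation on `T` is of spherical type: its Coxeter group is finite. -/
def SphericalType (A : ArtinData S) (T : Set S) : Prop :=
  Finite (PresentedGroup (coxRels A T))

/-- The induced presentation on `T` is of large type: all labels are `≥ 3` (possibly `∞`). -/
def LargeTypeOn (A : ArtinData S) (T : Set S) : Prop :=
  ∀ x ∈ T, ∀ y ∈ T, x ≠ y → 3 ≤ A.m x y

/-! ### Words and their values -/

theorem IsRel.symm {A : ArtinData S} {u v : Word S} (h : IsRel A u v) : IsRel A v u := by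
  obtain ⟨s, t, k, hst, hk, hu, hv⟩ := h
  exact ⟨t, s, k, hst.symm, by rw [A.symm, hk], hv, hu⟩

theorem wordInv_append (u v : Word S) : wordInv (u ++ v) = wordInv v ++ wordInv u := by
  simp [wordInv]

theorem wordInv_wordInv (u : Word S) : wordInv (wordInv u) = u := by
  simp [wordInv, List.map_reverse, Function.comp_def]

theorem wordInv_length (u : Word S) : (wordInv u).length = u.length := by
  simp [wordInv]

theorem wordOver_append {T : Set S} {u v : Word S} :
    WordOver T (u ++ v) ↔ WordOver T u ∧ WordOver T v := by
  simp only [WordOver, List.mem_append]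
  exact ⟨fun h => ⟨fun l hl => h l (Or.inl hl), fun l hl => h l (Or.inr hl)⟩,
    fun h l hl => hl.elim (h.1 l) (h.2 l)⟩

theorem wordOver_singleton {T : Set S} {a : S × Bool} : WordOver T [a] ↔ a.1 ∈ T := by
  simp [WordOver]

theorem wordOver_nil {T : Set S} : WordOver T ([] : Word S) := by simp [WordOver]

theorem WordOver.wordInv {T : Set S} {u : Word S} (h : WordOver T u) :
    WordOver T (wordInv u) := by
  intro l hl
  simp only [ArtinTits.wordInv, List.mem_map, List.mem_reverse] at hl
  obtain ⟨a, ha, rfl⟩ := hl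
  exact h a ha

/-- The formal inverse of a letter. -/
def linv (a : S × Bool) : S × Bool := (a.1, !a.2)

@[simp] theorem linv_linv (a : S × Bool) : linv (linv a) = a := by simp [linv]

theorem eq_or_eq_linv {a b : S × Bool} (h : a.1 = b.1) : a = b ∨ a = linv b := by
  obtain ⟨x, i⟩ := a
  obtain ⟨y, j⟩ := b
  cases i <;> cases j <;> simp_all [linv]

section value

variable (A : ArtinData S)

theorem wbar_nil : wbar A ([] : Word S) = 1 := by
  simp only [wbar]
  exact map_one _

theorem wbar_append (u v : Word S) : wbar A (u ++ v) = wbar A u * wbar A v := by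
  simp only [wbar, ← FreeGroup.mul_mk, map_mul]

theorem wbar_wordInv (u : Word S) : wbar A (wordInv u) = (wbar A u)⁻¹ := by
  have : FreeGroup.mk (wordInv u) = (FreeGroup.mk u)⁻¹ := by
    rw [FreeGroup.inv_mk]; simp [wordInv, FreeGroup.invRev, List.map_reverse]
  simp only [wbar, this, map_inv]

theorem wbar_linv (a : S × Bool) : wbar A [linv a] = (wbar A [a])⁻¹ := by
  rw [← wbar_wordInv]; rfl

theorem wbar_cancel (a : S × Bool) : wbar A [a, linv a] = 1 := by
  rw [show [a, linv a] = [a] ++ [linv a] from rfl, wbar_append, wbar_linv, mul_inv_cancel]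

variable {A}

theorem IsRel.wbar_eq {u v : Word S} (h : IsRel A u v) : wbar A u = wbar A v :=
  PresentedGroup.mk_eq_mk_of_mul_inv_mem ⟨u, v, h, rfl⟩

/-- Evaluation of words in a group satisfying the defining relations only depends on the
element represented. -/
theorem lift_eq_of_wbar_eq {G : Type*} [Group G] (f : S → G)
    (hf : ∀ u v, IsRel A u v →
      FreeGroup.lift f (FreeGroup.mk u) = FreeGroup.lift f (FreeGroup.mk v))
    {w w' : Word S} (h : wbar A w = wbar A w') :
    FreeGroup.lift f (FreeGroup.mk w) = FreeGroup.lift f (FreeGroup.mk w') := by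
  have hr : ∀ r ∈ rels A, FreeGroup.lift f r = 1 := by
    rintro r ⟨u, v, huv, rfl⟩
    rw [map_mul, map_inv, hf u v huv, mul_inv_cancel]
  exact congrArg (PresentedGroup.toGroup hr) h

theorem wbar_map {S' : Type*} {A' : ArtinData S'} (f : S → S')
    (hf : ∀ u v, IsRel A u v →
      wbar A' (u.map fun l => (f l.1, l.2)) = wbar A' (v.map fun l => (f l.1, l.2)))
    {w w' : Word S} (h : wbar A w = wbar A w') :
    wbar A' (w.map fun l => (f l.1, l.2)) = wbar A' (w'.map fun l => (f l.1, l.2)) := by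
  have key : ∀ u : Word S, wbar A' (u.map fun l => (f l.1, l.2)) =
      FreeGroup.lift (fun x => wbar A' [(f x, true)]) (FreeGroup.mk u) := by
    intro u
    rw [FreeGroup.lift_mk]
    induction u with
    | nil => simp [wbar_nil]
    | cons a u ih =>
      rw [List.map_cons, List.map_cons, List.prod_cons, ← ih, ← List.singleton_append, wbar_append]
      congr 1
      obtain ⟨x, b⟩ := a
      cases b
      · exact wbar_linv A' (f x, true)
      · rfl
  rw [key, key]
  exact lift_eq_of_wbar_eq _ (fun u v huv => by rw [← key, ← key, hf u v huv]) h

/-- The exponent sum of a word. -/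
def esum (w : Word S) : ℤ := (w.map fun l => if l.2 then (1 : ℤ) else -1).sum

theorem esum_altWord (x y : S) (n : ℕ) : esum (altWord x y n) = n := by
  induction n generalizing x y with
  | zero => simp [altWord, esum]
  | succ n ih =>
    have := ih y x
    simp only [esum, altWord, List.map_cons, List.sum_cons, if_true] at this ⊢
    rw [this]; push_cast; ring

theorem esum_eq {w w' : Word S} (h : wbar A w = wbar A w') : esum w = esum w' := by
  have key : ∀ u : Word S, FreeGroup.lift (fun _ : S => Multiplicative.ofAdd (1 : ℤ))
      (FreeGroup.mk u) = Multiplicative.ofAdd (esum u) := by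
    intro u
    rw [FreeGroup.lift_mk]
    induction u with
    | nil => simp [esum]
    | cons a u ih =>
      rw [List.map_cons, List.prod_cons, ih]
      obtain ⟨x, b⟩ := a
      rw [show esum ((x, b) :: u) = (if b then (1 : ℤ) else -1) + esum u by simp [esum], ofAdd_add]
      cases b <;> simp
  have := lift_eq_of_wbar_eq (A := A) (fun _ : S => Multiplicative.ofAdd (1 : ℤ)) (by
    rintro u v ⟨s, t, k, -, -, rfl, rfl⟩
    rw [key, key, esum_altWord, esum_altWord]) h
  rw [key, key] at this
  exact Multiplicative.ofAdd.injective this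

theorem esum_le (w : Word S) : esum w ≤ w.length := by
  induction w with
  | nil => simp [esum]
  | cons a u ih =>
    simp only [esum, List.map_cons, List.sum_cons, List.length_cons] at ih ⊢
    split_ifs <;> push_cast <;> omega

theorem esum_eq_length_iff (w : Word S) : esum w = w.length ↔ Positive w := by
  induction w with
  | nil => simp [esum, Positive]
  | cons a u ih =>
    have h := esum_le u
    simp only [esum, List.map_cons, List.sum_cons, List.length_cons, Positive,
      List.forall_mem_cons] at ih h ⊢
    rw [← ih]
    obtain ⟨x, b⟩ := a
    cases b
    · simp only [Bool.false_eq_true, if_false, false_and, iff_false]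
      omega
    · simp only [if_true, true_and]
      omega

theorem parity_esum (w : Word S) : (w.length : ℤ) % 2 = esum w % 2 := by
  induction w with
  | nil => simp [esum]
  | cons a u ih =>
    simp only [esum, List.map_cons, List.sum_cons, List.length_cons] at ih ⊢
    split_ifs <;> push_cast <;> omega

theorem parity_eq {w w' : Word S} (h : wbar A w = wbar A w') : w.length % 2 = w'.length % 2 := by
  have := parity_esum w
  have := parity_esum w'
  have := esum_eq h
  omega

theorem positive_wordInv {w : Word S} : Positive (wordInv w) ↔ Negative w := by
  simp only [Positive, Negative, wordInv, List.mem_map, List.mem_reverse]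
  constructor
  · intro h l hl
    simpa using h _ ⟨l, hl, rfl⟩
  · rintro h _ ⟨l, hl, rfl⟩
    simp [h l hl]

end value

/-! ### Reversible transformations -/

/-- A transformation of type 1, or of type 2 with inverse of type 2. -/
def RStep (A : ArtinData S) (w w' : Word S) : Prop :=
  Step1 A w w' ∨ (Step2 A w w' ∧ Step2 A w' w)

/-- The equivalence relation generated by the reversible transformations. -/
def REq (A : ArtinData S) : Word S → Word S → Prop := Relation.ReflTransGen (RStep A)

theorem Step1.symm {A : ArtinData S} {w w' : Word S} (h : Step1 A w w') : Step1 A w' w := by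
  obtain ⟨x, y, u, v, huv, h⟩ := h
  exact ⟨x, y, v, u, huv.symm, h.imp And.symm And.symm⟩

theorem RStep.symm {A : ArtinData S} {w w' : Word S} (h : RStep A w w') : RStep A w' w :=
  h.imp Step1.symm And.symm

theorem REq.symm {A : ArtinData S} {w w' : Word S} (h : REq A w w') : REq A w' w := by
  induction h with
  | refl => exact Relation.ReflTransGen.refl
  | tail _ h ih => exact Relation.ReflTransGen.head h.symm ih

theorem REq.trans {A : ArtinData S} {u v w : Word S} (h : REq A u v) (h' : REq A v w) :
    REq A u w := Relation.ReflTransGen.trans h h'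

theorem REq.steps12 {A : ArtinData S} {w w' : Word S} (h : REq A w w') : Steps12 A w w' :=
  Relation.ReflTransGen.lift id (fun _ _ h => h.imp id And.left) _ _ h

theorem Step1.append {A : ArtinData S} {w w' : Word S} (x y : Word S) (h : Step1 A w w') :
    Step1 A (x ++ w ++ y) (x ++ w' ++ y) := by
  obtain ⟨p, q, u, v, huv, h⟩ := h
  refine ⟨x ++ p, q ++ y, u, v, huv, h.imp ?_ ?_⟩ <;> rintro ⟨rfl, rfl⟩ <;> simp

theorem Step2.append {A : ArtinData S} {w w' : Word S} (x y : Word S) (hs : Step2 A w w') :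
    Step2 A (x ++ w ++ y) (x ++ w' ++ y) := by
  refine hs.imp ?_ ?_
  · rintro ⟨p, q, u₁, u₂, v₁, v₂, hrel, h1, h2, rfl, rfl⟩
    exact ⟨x ++ p, q ++ y, u₁, u₂, v₁, v₂, hrel, h1, h2, by simp, by simp⟩
  · rintro ⟨p, q, u₁, u₂, v₁, v₂, hrel, h1, h2, rfl, rfl⟩
    exact ⟨x ++ p, q ++ y, u₁, u₂, v₁, v₂, hrel, h1, h2, by simp, by simp⟩

theorem RStep.append {A : ArtinData S} {w w' : Word S} (x y : Word S) (h : RStep A w w') :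
    RStep A (x ++ w ++ y) (x ++ w' ++ y) :=
  h.imp (Step1.append x y) fun h => ⟨h.1.append x y, h.2.append x y⟩

theorem REq.append {A : ArtinData S} {w w' : Word S} (x y : Word S) (h : REq A w w') :
    REq A (x ++ w ++ y) (x ++ w' ++ y) :=
  Relation.ReflTransGen.lift (fun w => x ++ w ++ y) (fun _ _ h => h.append x y) _ _ h

theorem REq.of_rel {A : ArtinData S} {u v : Word S} (h : IsRel A u v) : REq A u v :=
  Relation.ReflTransGen.single (Or.inl ⟨[], [], v, u, h.symm, Or.inl ⟨by simp, by simp⟩⟩)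

theorem Step1.wbar_eq {A : ArtinData S} {w w' : Word S} (h : Step1 A w w') :
    wbar A w = wbar A w' := by
  obtain ⟨x, y, u, v, huv, ⟨rfl, rfl⟩ | ⟨rfl, rfl⟩⟩ := h
  · simp only [wbar_append, huv.wbar_eq]
  · simp only [wbar_append, wbar_wordInv, huv.wbar_eq]

theorem Step1.wordInv {A : ArtinData S} {w w' : Word S} (h : Step1 A w w') :
    Step1 A (wordInv w) (wordInv w') := by
  obtain ⟨x, y, u, v, huv, h⟩ := h
  refine ⟨ArtinTits.wordInv y, ArtinTits.wordInv x, u, v, huv, h.symm.imp ?_ ?_⟩ <;>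
    rintro ⟨rfl, rfl⟩ <;> simp [wordInv_append, wordInv_wordInv]

/-! ### Dihedral groups: alternating words -/

/-- The alternating word with `n` letters of sign `σ` over a two-letter alphabet, beginning
with the letter `b`. -/
def ab (b σ : Bool) : ℕ → Word Bool
  | 0 => []
  | n + 1 => (b, σ) :: ab (!b) σ n

theorem altWord_bool (b : Bool) (n : ℕ) : altWord b (!b) n = ab b true n := by
  induction n generalizing b with
  | zero => rfl
  | succ n ih =>
    have := ih (!b)
    rw [Bool.not_not] at this
    simp [altWord, ab, this]

theorem ab_length (b σ : Bool) (n : ℕ) : (ab b σ n).length = n := by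
  induction n generalizing b with
  | zero => rfl
  | succ n ih => simp [ab, ih]

theorem ab_add (b σ : Bool) (m n : ℕ) :
    ab b σ (m + n) = ab b σ m ++ ab (b ^^ m.bodd) σ n := by
  induction m generalizing b with
  | zero => simp [ab]
  | succ m ih => rw [Nat.add_right_comm]; simp [ab, ih, Nat.bodd_succ]

theorem ab_succ' (b σ : Bool) (n : ℕ) : ab b σ (n + 1) = ab b σ n ++ [(b ^^ n.bodd, σ)] := by
  rw [ab_add]; rfl

theorem wordInv_ab (b σ : Bool) (n : ℕ) :
    wordInv (ab b σ (n + 1)) = ab (b ^^ n.bodd) (!σ) (n + 1) := by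
  induction n generalizing b with
  | zero => simp [ab, wordInv]
  | succ n ih =>
    rw [ab, ← List.singleton_append, wordInv_append, ih, ab_succ' _ _ (n + 1)]
    simp [wordInv, Nat.bodd_succ]

theorem ab_sign {b σ : Bool} {n : ℕ} {l : Bool × Bool} (h : l ∈ ab b σ n) : l.2 = σ := by
  induction n generalizing b with
  | zero => simp [ab] at h
  | succ n ih =>
    rcases List.mem_cons.1 h with rfl | h
    · rfl
    · exact ih h

/-- The dihedral Artin data with label `M`. -/
def dih (M : ℕ) (hM : 2 ≤ M) : ArtinData Bool where
  m _ _ := M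
  symm _ _ := rfl
  two_le _ _ _ := by exact_mod_cast hM

theorem isRel_dih {M : ℕ} {hM : 2 ≤ M} {u v : Word Bool} :
    IsRel (dih M hM) u v ↔ ∃ b, u = ab b true M ∧ v = ab (!b) true M := by
  constructor
  · rintro ⟨s, t, k, hst, hk, rfl, rfl⟩
    obtain rfl : M = k := by simpa [dih] using hk
    obtain rfl : t = !s := by cases s <;> cases t <;> simp_all
    refine ⟨s, altWord_bool _ _, ?_⟩
    have := altWord_bool (!s) M
    rwa [Bool.not_not] at this
  · rintro ⟨b, rfl, rfl⟩
    refine ⟨b, !b, M, by simp, rfl, (altWord_bool _ _).symm, ?_⟩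
    have := altWord_bool (!b) M
    rw [Bool.not_not] at this
    exact this.symm

/-! ### Dihedral groups: an action detecting normal forms -/

/-- The state with Garside exponent `k`, last letter `e`, and runs of lengths `R`, the last run
coming first. -/
def mkState (k : ℤ) (e : Bool) (R : List ℕ) : ℤ × Bool × List ℕ :=
  (k, if R = [] then false else e, R)

/-- Validity of a state. -/
def ValidState (M : ℕ) (y : ℤ × Bool × List ℕ) : Prop :=
  (y.2.2 = [] → y.2.1 = false) ∧ ∀ g ∈ y.2.2, 1 ≤ g ∧ g < M

/-- Right multiplication of a state by the positive letter `b`. -/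
def actP (M : ℕ) (b : Bool) : ℤ × Bool × List ℕ → ℤ × Bool × List ℕ
  | (k, _, []) => mkState k b [1]
  | (k, e, g :: R) => if e = b then mkState k b (1 :: g :: R)
      else if g + 1 = M then mkState (k + 1) (!b) R else mkState k b ((g + 1) :: R)

/-- Right multiplication of a state by the negative letter `b`. -/
def actN (M : ℕ) (b : Bool) : ℤ × Bool × List ℕ → ℤ × Bool × List ℕ
  | (k, _, []) => mkState (k - 1) (!b) [M - 1]
  | (k, e, g :: R) => if e = b then
        (if g = 1 then mkState k b R else mkState k (!b) ((g - 1) :: R))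
      else mkState (k - 1) (!b) ((M - 1) :: g :: R)

theorem mkState_nil (k : ℤ) (e e' : Bool) : mkState k e [] = mkState k e' [] := by
  simp [mkState]

theorem actP_same (M : ℕ) (b : Bool) (k : ℤ) (R : List ℕ) :
    actP M b (mkState k b R) = mkState k b (1 :: R) := by
  cases R <;> simp [actP, mkState]

theorem actP_diff (M : ℕ) (b : Bool) (k : ℤ) (g : ℕ) (R : List ℕ) :
    actP M b (mkState k (!b) (g :: R)) =
      if g + 1 = M then mkState (k + 1) (!b) R else mkState k b ((g + 1) :: R) := by
  simp [actP, mkState]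

theorem actN_same (M : ℕ) (b : Bool) (k : ℤ) (g : ℕ) (R : List ℕ) :
    actN M b (mkState k b (g :: R)) =
      if g = 1 then mkState k b R else mkState k (!b) ((g - 1) :: R) := by
  simp [actN, mkState]

theorem actN_diff (M : ℕ) (b : Bool) (k : ℤ) (R : List ℕ) :
    actN M b (mkState k (!b) R) = mkState (k - 1) (!b) ((M - 1) :: R) := by
  cases R <;> simp [actN, mkState]

theorem validState_mkState {M : ℕ} {k : ℤ} {e : Bool} {R : List ℕ} :
    ValidState M (mkState k e R) ↔ ∀ g ∈ R, 1 ≤ g ∧ g < M := by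
  simp +contextual [ValidState, mkState]

theorem ValidState.exists_eq {M : ℕ} {y : ℤ × Bool × List ℕ} (h : ValidState M y) :
    ∃ k e R, y = mkState k e R ∧ ∀ g ∈ R, 1 ≤ g ∧ g < M := by
  obtain ⟨k, e, R⟩ := y
  refine ⟨k, e, R, ?_, h.2⟩
  by_cases hR : R = []
  · have := h.1 hR
    simp_all [mkState]
  · simp [mkState, hR]

theorem mkState_cases (e b : Bool) (R : List ℕ) (k : ℤ) :
    mkState k e R = mkState k b R ∨ ∃ g R', R = g :: R' ∧ e = !b := by
  cases R with
  | nil => exact Or.inl (mkState_nil _ _ _)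
  | cons g R' =>
    by_cases h : e = b
    · exact Or.inl (by rw [h])
    · exact Or.inr ⟨g, R', rfl, by cases e <;> cases b <;> simp_all⟩

theorem mkState_cases' (e b : Bool) (R : List ℕ) (k : ℤ) :
    mkState k e R = mkState k (!b) R ∨ ∃ g R', R = g :: R' ∧ e = b := by
  simpa using mkState_cases e (!b) R k

theorem actP_valid {M : ℕ} (hM : 2 ≤ M) (b : Bool) {y : ℤ × Bool × List ℕ}
    (hy : ValidState M y) : ValidState M (actP M b y) ∧ actN M b (actP M b y) = y := by
  obtain ⟨k, e, R, rfl, hR⟩ := hy.exists_eq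
  rcases mkState_cases e b R k with h | ⟨g, R, rfl, rfl⟩
  · rw [h, actP_same, validState_mkState, actN_same]
    refine ⟨?_, by simp⟩
    simp only [List.forall_mem_cons]
    exact ⟨by omega, hR⟩
  · rw [List.forall_mem_cons] at hR
    rw [actP_diff]
    split_ifs with h
    · rw [validState_mkState, actN_diff]
      refine ⟨hR.2, ?_⟩
      rw [show M - 1 = g by omega, add_sub_cancel_right]
    · rw [validState_mkState, actN_same, if_neg (by omega), Nat.add_sub_cancel]
      simp only [List.forall_mem_cons]
      exact ⟨⟨by omega, hR.2⟩, trivial⟩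

theorem actN_valid {M : ℕ} (hM : 2 ≤ M) (b : Bool) {y : ℤ × Bool × List ℕ}
    (hy : ValidState M y) : ValidState M (actN M b y) ∧ actP M b (actN M b y) = y := by
  obtain ⟨k, e, R, rfl, hR⟩ := hy.exists_eq
  rcases mkState_cases' e b R k with h | ⟨g, R, rfl, rfl⟩
  · rw [h, actN_diff, validState_mkState, actP_diff]
    refine ⟨?_, by rw [if_pos (by omega), sub_add_cancel]⟩
    simp only [List.forall_mem_cons]
    exact ⟨by omega, hR⟩
  · rw [List.forall_mem_cons] at hR
    rw [actN_same]
    split_ifs with h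
    · rw [validState_mkState, actP_same, h]
      exact ⟨hR.2, rfl⟩
    · rw [validState_mkState, actP_diff, if_neg (by omega), Nat.sub_add_cancel hR.1.1]
      simp only [List.forall_mem_cons]
      exact ⟨⟨by omega, hR.2⟩, trivial⟩

/-- Right multiplication of a state by a word. -/
def run (M : ℕ) (w : Word Bool) (y : ℤ × Bool × List ℕ) : ℤ × Bool × List ℕ :=
  w.foldl (fun y l => if l.2 then actP M l.1 y else actN M l.1 y) y

theorem run_append (M : ℕ) (u v : Word Bool) (y : ℤ × Bool × List ℕ) :
    run M (u ++ v) y = run M v (run M u y) := by simp [run]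

theorem run_cons_true (M : ℕ) (b : Bool) (v : Word Bool) (y : ℤ × Bool × List ℕ) :
    run M ((b, true) :: v) y = run M v (actP M b y) := by simp [run]

theorem run_cons_false (M : ℕ) (b : Bool) (v : Word Bool) (y : ℤ × Bool × List ℕ) :
    run M ((b, false) :: v) y = run M v (actN M b y) := by simp [run]

theorem run_nil (M : ℕ) (y : ℤ × Bool × List ℕ) : run M [] y = y := rfl

theorem run_valid {M : ℕ} (hM : 2 ≤ M) (w : Word Bool) {y : ℤ × Bool × List ℕ}
    (hy : ValidState M y) : ValidState M (run M w y) := by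
  induction w generalizing y with
  | nil => exact hy
  | cons l w ih =>
    obtain ⟨b, σ⟩ := l
    cases σ
    · rw [run_cons_false]; exact ih (actN_valid hM b hy).1
    · rw [run_cons_true]; exact ih (actP_valid hM b hy).1

theorem run_pos_extend {M : ℕ} {e : Bool} {k : ℤ} {g : ℕ} {R : List ℕ} {n : ℕ}
    (h : g + n < M) :
    run M (ab (!e) true n) (mkState k e (g :: R)) = mkState k (e ^^ n.bodd) ((g + n) :: R) := by
  induction n generalizing e g with
  | zero => simp [ab, run]
  | succ n ih =>
    have := actP_diff M (!e) k g R
    rw [Bool.not_not, if_neg (by omega)] at this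
    rw [ab, run_cons_true, this, ih (by omega), Nat.add_right_comm]
    simp [Nat.bodd_succ, Nat.add_assoc]

theorem run_pos_new {M : ℕ} {e : Bool} {k : ℤ} {R : List ℕ} {n : ℕ} (h : n + 1 < M) :
    run M (ab e true (n + 1)) (mkState k e R) = mkState k (e ^^ n.bodd) ((n + 1) :: R) := by
  rw [ab, run_cons_true, actP_same, run_pos_extend (by omega), Nat.add_comm]

theorem run_neg_extend {M : ℕ} {e : Bool} {k : ℤ} {g : ℕ} {R : List ℕ} {n : ℕ} (h : n < g) :
    run M (ab e false n) (mkState k e (g :: R)) = mkState k (e ^^ n.bodd) ((g - n) :: R) := by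
  induction n generalizing e g with
  | zero => simp [ab, run]
  | succ n ih =>
    rw [ab, run_cons_false, actN_same, if_neg (by omega), ih (by omega)]
    simp [Nat.bodd_succ, Nat.sub_sub, Nat.add_comm]

theorem run_neg_new {M : ℕ} {e : Bool} {k : ℤ} {R : List ℕ} {n : ℕ} (h : n + 1 < M) :
    run M (ab (!e) false (n + 1)) (mkState k e R) =
      mkState (k - 1) (e ^^ n.bodd) ((M - (n + 1)) :: R) := by
  have := actN_diff M (!e) k R
  rw [Bool.not_not] at this
  rw [ab, run_cons_false, this, Bool.not_not, run_neg_extend (by omega)]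
  congr 2; omega

theorem run_delta_same {M : ℕ} (hM : 2 ≤ M) (e : Bool) (k : ℤ) (R : List ℕ) :
    run M (ab e true M) (mkState k e R) = mkState (k + 1) (e ^^ M.bodd) R := by
  obtain ⟨n, rfl⟩ := Nat.exists_eq_add_of_le' hM
  have := actP_diff (n + 2) (e ^^ (n + 1).bodd) k (n + 1) R
  rw [if_pos rfl, show (!(e ^^ (n + 1).bodd)) = (e ^^ n.bodd) by simp [Nat.bodd_succ]] at this
  rw [ab_succ', run_append, run_pos_new (by omega), run_cons_true, this, run_nil]
  simp [Nat.bodd_succ]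

theorem run_delta {M : ℕ} (hM : 2 ≤ M) (b e : Bool) (k : ℤ) {R : List ℕ}
    (hR : ∀ g ∈ R, 1 ≤ g ∧ g < M) :
    run M (ab b true M) (mkState k e R) = mkState (k + 1) (e ^^ M.bodd) R := by
  rcases mkState_cases e b R k with h | ⟨g, R', rfl, rfl⟩
  · rw [h, run_delta_same hM]
    rcases mkState_cases b e R k with h' | ⟨g, R', rfl, rfl⟩
    · cases R with
      | nil => exact mkState_nil _ _ _
      | cons g R => simp [mkState] at h'; rw [h']
    · simp [mkState] at h
  · rw [List.forall_mem_cons] at hR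
    obtain ⟨n, hn⟩ : ∃ n, M = n + 1 + g := ⟨M - 1 - g, by omega⟩
    obtain ⟨j, rfl⟩ : ∃ j, g = j + 1 := ⟨g - 1, by omega⟩
    have h1 := run_pos_extend (M := M) (e := !b) (k := k) (R := R') (g := j + 1) (n := n)
      (by omega)
    rw [Bool.not_not] at h1
    have h2 := actP_diff M (b ^^ n.bodd) k (j + 1 + n) R'
    rw [if_pos (by omega), show (!(b ^^ n.bodd)) = (!b ^^ n.bodd) by simp] at h2
    have h3 := run_pos_new (M := M) (e := !b ^^ n.bodd) (k := k + 1) (R := R') (n := j)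
      (by omega)
    rw [show ab b true M = ab b true (n + 1 + (j + 1)) by rw [hn], ab_add, ab_succ', run_append,
      run_append, h1, run_cons_true, h2, run_nil,
      show (b ^^ (n + 1).bodd) = (!b ^^ n.bodd) by simp [Nat.bodd_succ], h3, hn]
    simp [Nat.bodd_succ]

section dihGroup

variable {M : ℕ} {hM : 2 ≤ M}

theorem run_eq {w w' : Word Bool} (h : wbar (dih M hM) w = wbar (dih M hM) w')
    {y : ℤ × Bool × List ℕ} (hy : ValidState M y) : run M w y = run M w' y := by
  let act : Bool → Equiv.Perm {y // ValidState M y} := fun b =>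
    { toFun := fun y => ⟨actP M b y, (actP_valid hM b y.2).1⟩
      invFun := fun y => ⟨actN M b y, (actN_valid hM b y.2).1⟩
      left_inv := fun y => Subtype.ext (actP_valid hM b y.2).2
      right_inv := fun y => Subtype.ext (actN_valid hM b y.2).2 }
  have key : ∀ (u : Word Bool) (y : {y // ValidState M y}),
      (((FreeGroup.lift (fun b => (act b)⁻¹) (FreeGroup.mk u))⁻¹ y :
        {y // ValidState M y}) : ℤ × Bool × List ℕ) = run M u y := by
    intro u
    induction u with
    | nil => intro y; simp [FreeGroup.lift_mk, run]
    | cons l u ih =>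
      intro y
      rw [FreeGroup.lift_mk] at ih ⊢
      obtain ⟨b, σ⟩ := l
      rw [List.map_cons, List.prod_cons, mul_inv_rev, Equiv.Perm.mul_apply, ih]
      cases σ
      · rw [run_cons_false]; simp; rfl
      · rw [run_cons_true]; simp; rfl
  have := lift_eq_of_wbar_eq (fun b => (act b)⁻¹) (by
    intro u v huv
    obtain ⟨b, rfl, rfl⟩ := isRel_dih.1 huv
    rw [← inv_inj]
    ext1 y
    apply Subtype.ext
    rw [key, key]
    obtain ⟨k, e, R, h, hR⟩ := y.2.exists_eq
    rw [h, run_delta hM _ _ _ hR, run_delta hM _ _ _ hR]) h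
  rw [← key w ⟨y, hy⟩, ← key w' ⟨y, hy⟩, this]

end dihGroup

theorem Geodesic.freelyReduced {A : ArtinData S} {w : Word S} (h : Geodesic A w) :
    FreelyReduced w := by
  rintro x y s b rfl
  have := h (x ++ y) (by
    simp only [wbar_append, mul_assoc]
    rw [show [(s, b), (s, !b)] = [(s, b), linv (s, b)] from rfl, wbar_cancel, one_mul])
  simp at this

theorem Geodesic.wordInv {A : ArtinData S} {w : Word S} (h : Geodesic A w) :
    Geodesic A (wordInv w) := by
  intro w' hw'
  rw [wordInv_length, ← wordInv_length w']
  apply h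
  rw [wbar_wordInv, hw', wbar_wordInv, inv_inv]

theorem Geodesic.length_eq {A : ArtinData S} {w w' : Word S} (h : Geodesic A w)
    (h' : Geodesic A w') (e : wbar A w = wbar A w') : w.length = w'.length :=
  le_antisymm (h _ e.symm) (h' _ e)

theorem Geodesic.congr {A : ArtinData S} {w w' : Word S} (h : Geodesic A w)
    (e : wbar A w = wbar A w') (hl : w.length = w'.length) : Geodesic A w' := by
  intro v hv
  rw [← hl]
  exact h v (hv.trans e.symm)

theorem Geodesic.positive_congr {A : ArtinData S} {w w' : Word S} (h : Geodesic A w)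
    (h' : Geodesic A w') (e : wbar A w = wbar A w') (hp : Positive w) : Positive w' := by
  rw [← esum_eq_length_iff] at hp ⊢
  rw [← esum_eq e, ← h.length_eq h' e, hp]

theorem Geodesic.negative_congr {A : ArtinData S} {w w' : Word S} (h : Geodesic A w)
    (h' : Geodesic A w') (e : wbar A w = wbar A w') (hp : Negative w) : Negative w' := by
  rw [← positive_wordInv] at hp ⊢
  exact h.wordInv.positive_congr h'.wordInv (by rw [wbar_wordInv, e, wbar_wordInv]) hp

section dihGroup

variable {M : ℕ} {hM : 2 ≤ M}

theorem wbar_delta (b c : Bool) :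
    wbar (dih M hM) (ab b true M) = wbar (dih M hM) (ab c true M) := by
  by_cases h : c = b
  · rw [h]
  · obtain rfl : c = !b := by cases b <;> cases c <;> simp_all
    exact (isRel_dih.2 ⟨b, rfl, rfl⟩).wbar_eq

/-- Conjugation by the Garside element, on words. -/
def garsideConj (M : ℕ) (w : Word Bool) : Word Bool := w.map fun l => (l.1 ^^ M.bodd, l.2)

theorem garsideConj_garsideConj (w : Word Bool) : garsideConj M (garsideConj M w) = w := by
  simp [garsideConj, Function.comp_def]

theorem garsideConj_length (w : Word Bool) : (garsideConj M w).length = w.length := by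
  simp [garsideConj]

theorem wbar_mul_delta (b : Bool) (w : Word Bool) :
    wbar (dih M hM) w * wbar (dih M hM) (ab b true M) =
      wbar (dih M hM) (ab b true M) * wbar (dih M hM) (garsideConj M w) := by
  have pos : ∀ c, wbar (dih M hM) [(c, true)] * wbar (dih M hM) (ab b true M) =
      wbar (dih M hM) (ab b true M) * wbar (dih M hM) [(c ^^ M.bodd, true)] := by
    intro c
    rw [wbar_delta b (!c), ← wbar_append, List.singleton_append, wbar_delta (!c) c, ← wbar_append,
      ← ab_succ', ab]
  induction w with
  | nil => simp [garsideConj, wbar_nil]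
  | cons l w ih =>
    rw [← List.singleton_append, wbar_append, mul_assoc, ih, ← mul_assoc]
    have : wbar (dih M hM) [l] * wbar (dih M hM) (ab b true M) =
        wbar (dih M hM) (ab b true M) * wbar (dih M hM) [(l.1 ^^ M.bodd, l.2)] := by
      obtain ⟨c, σ⟩ := l
      cases σ
      · have h1 := wbar_linv (dih M hM) (c, true)
        have h2 := wbar_linv (dih M hM) (c ^^ M.bodd, true)
        simp only [linv, Bool.not_true] at h1 h2
        rw [h1, h2, inv_mul_eq_iff_eq_mul, ← mul_assoc, pos, mul_assoc, mul_inv_cancel, mul_one]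
      · exact pos c
    rw [this, mul_assoc, ← wbar_append]
    rfl

theorem delta_mul_neg (b c : Bool) :
    wbar (dih M hM) (ab b true M) * wbar (dih M hM) [(c, false)] =
      wbar (dih M hM) (ab (c ^^ (M - 1).bodd) true (M - 1)) := by
  have h1 := wbar_linv (dih M hM) (c, true)
  simp only [linv, Bool.not_true] at h1
  obtain ⟨n, hn⟩ : ∃ n, M = n + 1 := ⟨M - 1, by omega⟩
  rw [h1, mul_inv_eq_iff_eq_mul, wbar_delta b (c ^^ (M - 1).bodd), ← wbar_append,
    show ab (c ^^ (M - 1).bodd) true M = ab (c ^^ (M - 1).bodd) true (M - 1 + 1) by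
      rw [Nat.sub_add_cancel (by omega)], ab_succ']
  simp

theorem neg_mul_delta (b c : Bool) :
    wbar (dih M hM) [(c, false)] * wbar (dih M hM) (ab b true M) =
      wbar (dih M hM) (ab (!c) true (M - 1)) := by
  have h1 := wbar_linv (dih M hM) (c, true)
  simp only [linv, Bool.not_true] at h1
  rw [h1, inv_mul_eq_iff_eq_mul, wbar_delta b c, ← wbar_append, List.singleton_append, ← ab,
    Nat.succ_eq_add_one, Nat.sub_add_cancel (by omega)]

theorem Geodesic.positive_of_delta {w : Word Bool} (h : Geodesic (dih M hM) w) {b : Bool}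
    (hb : ab b true M <:+: w) : Positive w := by
  obtain ⟨x, y, rfl⟩ := hb
  by_contra hp
  simp only [Positive, not_forall] at hp
  obtain ⟨⟨c, σ⟩, hl, hs⟩ := hp
  obtain rfl : σ = false := by simpa using hs
  simp only [List.mem_append] at hl
  rcases hl with (hl | hl) | hl
  · obtain ⟨p, q, rfl⟩ := List.append_of_mem hl
    have := h (p ++ ab (!c) true (M - 1) ++ garsideConj M q ++ y) (by
      rw [← List.singleton_append]
      simp only [wbar_append, mul_assoc]
      rw [← mul_assoc (wbar _ q), wbar_mul_delta, mul_assoc, ← mul_assoc (wbar _ [(c, false)]),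
        neg_mul_delta])
    simp [ab_length, garsideConj_length] at this
    omega
  · have := ab_sign hl
    simp at this
  · obtain ⟨p, q, rfl⟩ := List.append_of_mem hl
    have := h (x ++ garsideConj M p ++ ab (c ^^ (M - 1).bodd) true (M - 1) ++ q) (by
      rw [← List.singleton_append]
      simp only [wbar_append, mul_assoc]
      rw [← mul_assoc (wbar _ (ab b true M)) (wbar _ p), ← garsideConj_garsideConj (M := M) p,
        ← wbar_mul_delta, mul_assoc, ← mul_assoc (wbar _ (ab b true M)) (wbar _ [(c, false)]),
        delta_mul_neg, garsideConj_garsideConj])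
    simp [ab_length, garsideConj_length] at this
    omega

theorem infix_wordInv {u w : Word S} (h : u <:+: w) : wordInv u <:+: wordInv w := by
  obtain ⟨x, y, rfl⟩ := h
  exact ⟨wordInv y, wordInv x, by simp [wordInv_append]⟩

theorem infix_ab_wordInv {b σ : Bool} {w : Word Bool} (hM : 2 ≤ M) (h : ab b σ M <:+: w) :
    ∃ c, ab c (!σ) M <:+: wordInv w := by
  obtain ⟨n, rfl⟩ := Nat.exists_eq_add_of_le' hM
  have := infix_wordInv h
  rw [wordInv_ab] at this
  exact ⟨_, this⟩

theorem Geodesic.negative_of_delta {w : Word Bool} (h : Geodesic (dih M hM) w) {b : Bool}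
    (hb : ab b false M <:+: w) : Negative w := by
  obtain ⟨c, hc⟩ := infix_ab_wordInv hM hb
  exact positive_wordInv.1 (h.wordInv.positive_of_delta hc)

/-- Freely reduced words containing no alternating factor of length `M`. -/
def Short (M : ℕ) (w : Word Bool) : Prop :=
  FreelyReduced w ∧ ∀ b σ, ¬ ab b σ M <:+: w

theorem freelyReduced_wordInv {w : Word S} (h : FreelyReduced w) : FreelyReduced (wordInv w) := by
  intro x y s b hw
  apply h (wordInv y) (wordInv x) s b
  rw [← wordInv_wordInv w, hw]
  simp [wordInv]

theorem Short.wordInv {w : Word Bool} (hM : 2 ≤ M) (h : Short M w) : Short M (wordInv w) := by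
  refine ⟨freelyReduced_wordInv h.1, fun b σ hb => ?_⟩
  obtain ⟨c, hc⟩ := infix_ab_wordInv hM hb
  rw [wordInv_wordInv] at hc
  exact h.2 _ _ hc

theorem Geodesic.short {w : Word Bool} (h : Geodesic (dih M hM) w) (hp : ¬ Positive w)
    (hn : ¬ Negative w) : Short M w := by
  refine ⟨h.freelyReduced, fun b σ hb => ?_⟩
  cases σ
  · exact hn (h.negative_of_delta hb)
  · exact hp (h.positive_of_delta hb)

/-! ### Dihedral groups: block words -/

/-- The length of a block: a positive block of size `g` has `g` letters, a negative one `M - g`. -/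
def blockLen (M : ℕ) (σ : Bool) (g : ℕ) : ℕ := if σ then g else M - g

/-- The concatenation of the alternating blocks with the given sizes and signs. -/
def blocks (M : ℕ) : Bool → List ℕ → List Bool → Word Bool
  | f, g :: gs, σ :: ms =>
    ab (if σ then f else !f) σ (blockLen M σ g) ++
      blocks M (!(f ^^ (blockLen M σ g).bodd)) gs ms
  | _, _, _ => []

/-- The last letter coordinate after a sequence of blocks. -/
def blocksEnd (M : ℕ) : Bool → List ℕ → List Bool → Bool
  | f, g :: gs, σ :: ms => blocksEnd M (!(f ^^ (blockLen M σ g).bodd)) gs ms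
  | f, _, _ => f

/-- Sizes of blocks lie strictly between `0` and `M`. -/
def ValidSizes (M : ℕ) (gs : List ℕ) : Prop := ∀ g ∈ gs, 1 ≤ g ∧ g < M

theorem validSizes_cons {g : ℕ} {gs : List ℕ} :
    ValidSizes M (g :: gs) ↔ (1 ≤ g ∧ g < M) ∧ ValidSizes M gs := by
  simp [ValidSizes]

theorem run_block {f σ : Bool} {k : ℤ} {g : ℕ} {R : List ℕ} (h : 1 ≤ g ∧ g < M) :
    run M (ab (if σ then f else !f) σ (blockLen M σ g)) (mkState k f R) =
      mkState (k - if σ then 0 else 1) (!(f ^^ (blockLen M σ g).bodd)) (g :: R) := by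
  cases σ
  · obtain ⟨n, hn⟩ : ∃ n, M - g = n + 1 := ⟨M - g - 1, by omega⟩
    simp only [blockLen, Bool.false_eq_true, if_false]
    rw [hn, run_neg_new (by omega), show M - (n + 1) = g by omega]
    simp [Nat.bodd_succ]
  · obtain ⟨n, rfl⟩ : ∃ n, g = n + 1 := ⟨g - 1, by omega⟩
    simp only [blockLen, if_true]
    rw [run_pos_new (by omega)]
    simp [Nat.bodd_succ]

theorem run_blocks {f : Bool} {k : ℤ} {gs : List ℕ} {ms : List Bool} {R : List ℕ}
    (h : ValidSizes M gs) (hl : gs.length = ms.length) :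
    run M (blocks M f gs ms) (mkState k f R) =
      mkState (k - ms.count false) (blocksEnd M f gs ms) (gs.reverse ++ R) := by
  induction gs generalizing ms f k R with
  | nil =>
    cases ms with
    | nil => simp [blocks, blocksEnd, run]
    | cons => simp at hl
  | cons g gs ih =>
    cases ms with
    | nil => simp at hl
    | cons σ ms =>
      rw [validSizes_cons] at h
      rw [blocks, run_append, run_block h.1, ih h.2 (by simpa using hl), blocksEnd]
      cases σ <;> simp
      congr 1; ring

theorem blocksEnd_inj {f f' : Bool} {gs : List ℕ} {ms : List Bool}
    (h : blocksEnd M f gs ms = blocksEnd M f' gs ms) : f = f' := by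
  induction gs generalizing ms f f' with
  | nil => simpa [blocksEnd] using h
  | cons g gs ih =>
    cases ms with
    | nil => simpa [blocksEnd] using h
    | cons σ ms =>
      have := ih h
      simpa using this

theorem blocks_length (f : Bool) (gs : List ℕ) (ms : List Bool) :
    (blocks M f gs ms).length = (List.zipWith (blockLen M) ms gs).sum := by
  induction gs generalizing ms f with
  | nil => cases ms <;> simp [blocks]
  | cons g gs ih =>
    cases ms with
    | nil => simp [blocks]
    | cons σ ms => simp [blocks, ab_length, ih]

theorem blockLen_pos {σ : Bool} {g : ℕ} (h : 1 ≤ g ∧ g < M) : 1 ≤ blockLen M σ g := by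
  cases σ <;> simp [blockLen] <;> omega

theorem blocks_last {f b σ : Bool} {gs : List ℕ} {ms : List Bool} (h : ValidSizes M gs)
    (hl : (blocks M f gs ms).getLast? = some (b, σ)) :
    gs ≠ [] ∧ blocksEnd M f gs ms = if σ then b else !b := by
  induction gs generalizing ms f with
  | nil => simp [blocks] at hl
  | cons g gs ih =>
    cases ms with
    | nil => simp [blocks] at hl
    | cons τ ms =>
      rw [validSizes_cons] at h
      refine ⟨by simp, ?_⟩
      rw [blocks, List.getLast?_append] at hl
      rw [blocksEnd]
      cases hx : (blocks M (!(f ^^ (blockLen M τ g).bodd)) gs ms).getLast? with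
      | some l =>
        rw [hx] at hl
        simp only [Option.some_or, Option.some.injEq] at hl
        subst hl
        exact (ih h.2 hx).2
      | none =>
        rw [hx] at hl
        obtain ⟨n, hn⟩ : ∃ n, blockLen M τ g = n + 1 :=
          ⟨_, (Nat.sub_add_cancel (blockLen_pos h.1)).symm⟩
        rw [hn, ab_succ'] at hl
        simp only [Option.none_or, List.getLast?_append, List.getLast?_singleton, Option.some_or,
          Option.some.injEq, Prod.mk.injEq] at hl
        have hnil : gs = [] ∨ ms = [] := by
          rw [List.getLast?_eq_none_iff] at hx
          cases gs with
          | nil => exact Or.inl rfl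
          | cons g' gs =>
            cases ms with
            | nil => exact Or.inr rfl
            | cons τ' ms =>
              have := congrArg List.length hx
              rw [blocks, List.length_append, ab_length] at this
              have := blockLen_pos (σ := τ') (validSizes_cons.1 h.2).1
              simp at *
              omega
        have : ∀ e, blocksEnd M e gs ms = e := by
          intro e
          rcases hnil with rfl | rfl
          · rfl
          · cases gs <;> rfl
        rw [this, hn]
        obtain ⟨rfl, rfl⟩ := hl
        cases τ <;> simp [Nat.bodd_succ]

theorem flip_core {a b c d : ℕ} (habcd : a + b = c + d) (hM' : M = a + b + 2) (f : Bool) :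
    RStep (dih M hM) (ab (!f) false (a + 1) ++ ab (f ^^ a.bodd) true (c + 1))
      (ab f true (b + 1) ++ ab (!(f ^^ b.bodd)) false (d + 1)) := by
  have hpar : (a.bodd ^^ b.bodd) = (c.bodd ^^ d.bodd) := by
    rw [← Nat.bodd_add, ← Nat.bodd_add, habcd]
  have hrel : IsRel (dih M hM)
      (ab (f ^^ a.bodd) true (c + 1) ++ ab (!(f ^^ a.bodd ^^ c.bodd)) true (d + 1))
      (ab (!f ^^ a.bodd) true (a + 1) ++ ab f true (b + 1)) := by
    refine isRel_dih.2 ⟨f ^^ a.bodd, ?_, ?_⟩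
    · rw [show M = (c + 1) + (d + 1) by omega, ab_add _ _ (c + 1), Nat.bodd_succ]
      congr 2
      cases f <;> cases a.bodd <;> cases c.bodd <;> rfl
    · rw [show M = (a + 1) + (b + 1) by omega, ab_add _ _ (a + 1), Nat.bodd_succ]
      congr 2 <;> cases f <;> cases a.bodd <;> rfl
  have e1 : wordInv (ab (!f ^^ a.bodd) true (a + 1)) = ab (!f) false (a + 1) := by
    rw [wordInv_ab]; simp
  have e2 : wordInv (ab (!(f ^^ a.bodd ^^ c.bodd)) true (d + 1)) =
      ab (!(f ^^ b.bodd)) false (d + 1) := by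
    rw [wordInv_ab]
    congr 1
    revert hpar
    cases f <;> cases a.bodd <;> cases b.bodd <;> cases c.bodd <;> cases d.bodd <;> simp
  refine Or.inr ⟨Or.inl ⟨[], [], _, _, _, _, hrel, by simp [ab], by simp [ab], ?_, ?_⟩,
    Or.inr ⟨[], [], _, _, _, _, hrel, by simp [ab], by simp [ab], ?_, ?_⟩⟩ <;>
    simp only [List.nil_append, List.append_nil, e1, e2]

theorem bodd_sub {a b : ℕ} (h : b ≤ a) : (a - b).bodd = (a.bodd ^^ b.bodd) := by
  obtain ⟨c, rfl⟩ := Nat.exists_eq_add_of_le h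
  rw [Nat.add_sub_cancel_left, Nat.bodd_add]
  cases b.bodd <;> cases c.bodd <;> rfl

theorem flip_end (f : Bool) {g₁ g₂ : ℕ} (h₁ : g₁ ≤ M) (h₂ : g₂ ≤ M) :
    (!(!(f ^^ (M - g₁).bodd) ^^ g₂.bodd)) = !(!(f ^^ g₁.bodd) ^^ (M - g₂).bodd) := by
  rw [bodd_sub h₁, bodd_sub h₂]
  cases f <;> cases M.bodd <;> cases g₁.bodd <;> cases g₂.bodd <;> rfl

theorem bodd_pred (f : Bool) {n : ℕ} (h : 1 ≤ n) : (f ^^ (n - 1).bodd) = !(f ^^ n.bodd) := by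
  rw [bodd_sub h]
  cases f <;> cases n.bodd <;> rfl

theorem flip_blocks {f : Bool} {g₁ g₂ : ℕ} {gs : List ℕ} {ms : List Bool}
    (h₁ : 1 ≤ g₁ ∧ g₁ < M) (h₂ : 1 ≤ g₂ ∧ g₂ < M) :
    RStep (dih M hM) (blocks M f (g₁ :: g₂ :: gs) (false :: true :: ms))
      (blocks M f (g₁ :: g₂ :: gs) (true :: false :: ms)) := by
  have := (flip_core (hM := hM) (a := M - g₁ - 1) (b := g₁ - 1) (c := g₂ - 1) (d := M - g₂ - 1)
    (by omega) (by omega) f).append []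
      (blocks M (!(!(f ^^ (M - g₁).bodd) ^^ g₂.bodd)) gs ms)
  rw [Nat.sub_add_cancel (by omega), Nat.sub_add_cancel (by omega), Nat.sub_add_cancel (by omega),
    Nat.sub_add_cancel (by omega)] at this
  rw [bodd_pred f (by omega : 1 ≤ M - g₁), bodd_pred f h₁.1] at this
  simp only [blocks, blockLen, if_true, if_false, Bool.false_eq_true, ← List.append_assoc]
  rw [← flip_end f h₁.2.le h₂.2.le]
  simpa only [← List.append_assoc, List.nil_append] using this

theorem blocks_perm {ms ms' : List Bool} (hp : ms ~ ms') {f : Bool} {gs : List ℕ}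
    (h : ValidSizes M gs) (hl : gs.length = ms.length) :
    REq (dih M hM) (blocks M f gs ms) (blocks M f gs ms') ∧
      blocksEnd M f gs ms = blocksEnd M f gs ms' := by
  induction hp generalizing f gs with
  | nil => exact ⟨.refl, rfl⟩
  | cons σ _ ih =>
    cases gs with
    | nil => simp at hl
    | cons g gs =>
      rw [validSizes_cons] at h
      obtain ⟨h1, h2⟩ := ih (f := !(f ^^ (blockLen M σ g).bodd)) h.2 (by simpa using hl)
      refine ⟨?_, h2⟩
      have := h1.append (ab (if σ then f else !f) σ (blockLen M σ g)) []
      simpa [blocks] using this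
  | swap σ τ ms =>
    match gs, hl with
    | g₁ :: g₂ :: gs, hl =>
      rw [validSizes_cons, validSizes_cons] at h
      cases σ <;> cases τ
      · exact ⟨.refl, rfl⟩
      · refine ⟨.single (flip_blocks h.1 h.2.1).symm, ?_⟩
        exact congrArg (blocksEnd M · gs ms) (flip_end f h.1.2.le h.2.1.2.le).symm
      · refine ⟨.single (flip_blocks h.1 h.2.1), ?_⟩
        exact congrArg (blocksEnd M · gs ms) (flip_end f h.1.2.le h.2.1.2.le)
      · exact ⟨.refl, rfl⟩
  | trans hp₁ _ ih₁ ih₂ =>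
    obtain ⟨a1, a2⟩ := ih₁ (f := f) h hl
    obtain ⟨b1, b2⟩ := ih₂ (f := f) h (hl.trans hp₁.length_eq)
    exact ⟨a1.trans b1, a2.trans b2⟩

theorem Short.exists_blocks {w : Word Bool} (hM : 2 ≤ M) (h : Short M w) :
    ∃ f gs ms, ValidSizes M gs ∧ gs.length = ms.length ∧ w = blocks M f gs ms := by
  induction w with
  | nil => exact ⟨true, [], [], by simp [ValidSizes], rfl, rfl⟩
  | cons l w ih =>
    obtain ⟨f, gs, ms, hv, hl, rfl⟩ := ih ⟨fun x y s b e => h.1 (l :: x) y s b (by simp [e]),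
      fun b σ hb => h.2 b σ (hb.trans (List.infix_cons (List.infix_refl _)))⟩
    obtain ⟨b, σ⟩ := l
    have hnew : ∀ (f : Bool), (f = if σ then b else !b) →
        blocks M f ((if σ then 1 else M - 1) :: gs) (σ :: ms) = (b, σ) :: blocks M f gs ms := by
      rintro f rfl
      cases σ
      · simp [blocks, blockLen, show M - (M - 1) = 1 by omega, ab]
      · simp [blocks, blockLen, ab]
    have hnewv : ValidSizes M ((if σ then 1 else M - 1) :: gs) := by
      refine validSizes_cons.2 ⟨?_, hv⟩
      cases σ <;> simp <;> omega
    by_cases hf : f = if σ then b else !b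
    · exact ⟨f, _, _, hnewv, by simp [hl], (hnew f hf).symm⟩
    match gs, ms, hl with
    | [], [], _ =>
      refine ⟨if σ then b else !b, [if σ then 1 else M - 1], [σ], hnewv, rfl, ?_⟩
      rw [hnew _ rfl]; simp [blocks]
    | g :: gs, τ :: ms, hl =>
      have hf' : f = if σ then !b else b := by
        cases σ <;> cases b <;> cases f <;> simp_all
      obtain ⟨hg, hv'⟩ := validSizes_cons.1 hv
      obtain ⟨n, hn⟩ : ∃ n, blockLen M τ g = n + 1 :=
        ⟨_, (Nat.sub_add_cancel (blockLen_pos hg)).symm⟩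
      by_cases hτ : τ = σ
      · subst hτ
        have hword : (b, τ) :: blocks M f (g :: gs) (τ :: ms) =
            ab b τ (n + 1 + 1) ++ blocks M (!(f ^^ (blockLen M τ g).bodd)) gs ms := by
          rw [blocks, hn, hf']
          cases τ <;> simp [ab]
        have hlt : n + 1 + 1 < M := by
          have hle : n + 1 + 1 ≤ M := by
            rw [← hn]; cases τ <;> simp [blockLen] <;> omega
          refine lt_of_le_of_ne hle fun hh => h.2 b τ ?_
          rw [hword, ← hh]
          exact (List.prefix_append _ _).isInfix
        have hb : blockLen M τ (if τ then g + 1 else g - 1) = n + 1 + 1 := by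
          cases τ <;> simp [blockLen] at hn ⊢ <;> omega
        refine ⟨!f, (if τ then g + 1 else g - 1) :: gs, τ :: ms, validSizes_cons.2 ⟨?_, hv'⟩,
          by simpa using hl, ?_⟩
        · cases τ <;> simp [blockLen] at hn ⊢ <;> omega
        · rw [hword, blocks, hb, hn, hf']
          cases τ <;> simp [Nat.bodd_succ]
      · obtain rfl : τ = !σ := by cases σ <;> cases τ <;> simp_all
        exfalso
        apply h.1 [] (ab (!b) (!σ) n ++
          blocks M (!(f ^^ (blockLen M (!σ) g).bodd)) gs ms) b σ
        rw [blocks, hn, hf']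
        cases σ <;> simp [ab]

end dihGroup

theorem Step2.wordInv {A : ArtinData S} {w w' : Word S} (hs : Step2 A w w') :
    Step2 A (wordInv w) (wordInv w') := by
  refine hs.imp ?_ ?_
  · rintro ⟨p, q, u₁, u₂, v₁, v₂, hrel, h1, h2, rfl, rfl⟩
    exact ⟨ArtinTits.wordInv q, ArtinTits.wordInv p, v₁, v₂, u₁, u₂, hrel.symm, h2, h1,
      by simp [wordInv_append, wordInv_wordInv], by simp [wordInv_append, wordInv_wordInv]⟩
  · rintro ⟨p, q, u₁, u₂, v₁, v₂, hrel, h1, h2, rfl, rfl⟩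
    exact ⟨ArtinTits.wordInv q, ArtinTits.wordInv p, v₁, v₂, u₁, u₂, hrel.symm, h2, h1,
      by simp [wordInv_append, wordInv_wordInv], by simp [wordInv_append, wordInv_wordInv]⟩

theorem RStep.wordInv {A : ArtinData S} {w w' : Word S} (h : RStep A w w') :
    RStep A (wordInv w) (wordInv w') :=
  h.imp Step1.wordInv fun h => ⟨h.1.wordInv, h.2.wordInv⟩

theorem REq.wordInv {A : ArtinData S} {w w' : Word S} (h : REq A w w') :
    REq A (wordInv w) (wordInv w') :=
  Relation.ReflTransGen.lift ArtinTits.wordInv (fun _ _ h => h.wordInv) _ _ h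

theorem Step2.wbar_eq {A : ArtinData S} {w w' : Word S} (hs : Step2 A w w') :
    wbar A w = wbar A w' := by
  have key : ∀ u₁ u₂ v₁ v₂ : Word S, IsRel A (u₁ ++ u₂) (v₁ ++ v₂) →
      (wbar A v₁)⁻¹ * wbar A u₁ = wbar A v₂ * (wbar A u₂)⁻¹ := by
    intro u₁ u₂ v₁ v₂ h
    have := h.wbar_eq
    rw [wbar_append, wbar_append] at this
    rw [inv_mul_eq_iff_eq_mul, ← mul_assoc, eq_mul_inv_iff_mul_eq, this]
  rcases hs with ⟨p, q, u₁, u₂, v₁, v₂, hrel, h1, h2, rfl, rfl⟩ |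
    ⟨p, q, u₁, u₂, v₁, v₂, hrel, h1, h2, rfl, rfl⟩ <;>
  · have : (wbar A v₁)⁻¹ * (wbar A u₁ * wbar A q) = wbar A v₂ * ((wbar A u₂)⁻¹ * wbar A q) := by
      rw [← mul_assoc, key _ _ _ _ hrel, mul_assoc]
    simp only [wbar_append, wbar_wordInv, mul_assoc, this]

theorem REq.wbar_eq {A : ArtinData S} {w w' : Word S} (h : REq A w w') :
    wbar A w = wbar A w' := by
  induction h with
  | refl => rfl
  | tail _ h ih => exact ih.trans (h.elim Step1.wbar_eq fun h => h.1.wbar_eq)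

section dihGroup

variable {M : ℕ} {hM : 2 ≤ M}

theorem rEq_delta (b c : Bool) : REq (dih M hM) (ab b true M) (ab c true M) := by
  by_cases h : c = b
  · rw [h]; exact .refl
  · obtain rfl : c = !b := by cases b <;> cases c <;> simp_all
    exact REq.of_rel (isRel_dih.2 ⟨b, rfl, rfl⟩)

theorem positive_append {u v : Word S} : Positive (u ++ v) ↔ Positive u ∧ Positive v := by
  simp only [Positive, List.mem_append]
  exact ⟨fun h => ⟨fun l hl => h l (Or.inl hl), fun l hl => h l (Or.inr hl)⟩,
    fun h l hl => hl.elim (h.1 l) (h.2 l)⟩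

theorem positive_garsideConj {w : Word Bool} (h : Positive w) : Positive (garsideConj M w) := by
  simp only [Positive, garsideConj, List.mem_map]
  rintro _ ⟨l, hl, rfl⟩
  exact h l hl

theorem rEq_delta_comm {x : Word Bool} (hx : Positive x) (b c : Bool) :
    REq (dih M hM) (x ++ ab b true M) (ab c true M ++ garsideConj M x) := by
  induction x with
  | nil => simpa [garsideConj] using rEq_delta b c
  | cons l x ih =>
    obtain ⟨e, σ⟩ := l
    obtain rfl : σ = true := hx (e, σ) (by simp)
    have h1 := (ih fun l hl => hx l (by simp [hl])).append [(e, true)] []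
    have h2 := (rEq_delta (hM := hM) c (!e)).append [(e, true)] (garsideConj M x)
    have h3 := (rEq_delta (hM := hM) e c).append [] ((e ^^ M.bodd, true) :: garsideConj M x)
    have h4 : [(e, true)] ++ ab (!e) true M ++ garsideConj M x =
        [] ++ ab e true M ++ (e ^^ M.bodd, true) :: garsideConj M x := by
      have := ab_succ' e true M
      rw [ab] at this
      rw [List.singleton_append, this]; simp
    rw [h4] at h2
    simp only [List.append_nil, ← List.append_assoc] at h1 h2 h3
    exact (h1.trans h2).trans h3

/-- Powers of the Garside element, as words. -/
def garsidePow (M : ℕ) : ℕ → Word Bool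
  | 0 => []
  | k + 1 => ab true true M ++ garsidePow M k

theorem run_garsidePow (hM : 2 ≤ M) (n : ℕ) (k : ℤ) (e : Bool) :
    run M (garsidePow M n) (mkState k e []) = mkState (k + n) e [] := by
  induction n generalizing k e with
  | zero => simp [garsidePow, run]
  | succ n ih =>
    rw [garsidePow, run_append, run_delta hM _ _ _ (by simp), ih, mkState_nil _ _ e]
    congr 1; push_cast; ring

theorem blocks_signs {f τ : Bool} {gs : List ℕ} {ms : List Bool} (h : ValidSizes M gs)
    (hl : gs.length = ms.length) (hs : ∀ l ∈ blocks M f gs ms, l.2 = τ) :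
    ms = List.replicate gs.length τ := by
  induction gs generalizing f ms with
  | nil =>
    cases ms with
    | nil => rfl
    | cons => simp at hl
  | cons g gs ih =>
    cases ms with
    | nil => simp at hl
    | cons σ ms =>
      rw [validSizes_cons] at h
      simp only [blocks, List.mem_append] at hs
      have h1 := ih h.2 (by simpa using hl) fun l hl => hs l (Or.inr hl)
      obtain ⟨n, hn⟩ : ∃ n, blockLen M σ g = n + 1 :=
        ⟨_, (Nat.sub_add_cancel (blockLen_pos h.1)).symm⟩
      have h2 := hs (if σ then f else !f, σ) (Or.inl (by rw [hn]; simp [ab]))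
      simp only at h2
      rw [h2, h1]; rfl

theorem FreelyReduced.of_positive {w : Word S} (h : Positive w) : FreelyReduced w := by
  rintro x y s b rfl
  have h1 := h (s, b) (by simp)
  have h2 := h (s, !b) (by simp)
  simp_all

theorem positive_normal_form (hM : 2 ≤ M) (w : Word Bool) (hw : Positive w) :
    ∃ k f gs, ValidSizes M gs ∧ REq (dih M hM) w
      (garsidePow M k ++ blocks M f gs (List.replicate gs.length true)) := by
  induction hn : w.length using Nat.strong_induction_on generalizing w with
  | _ n ih =>
    by_cases hb : ∃ b, ab b true M <:+: w
    · obtain ⟨b, x, y, rfl⟩ := hb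
      rw [positive_append, positive_append] at hw
      obtain ⟨k, f, gs, hv, h⟩ := ih (garsideConj M x ++ y).length
        (by simp [← hn, ab_length, garsideConj_length]; omega) _
        (positive_append.2 ⟨positive_garsideConj hw.1.1, hw.2⟩) rfl
      refine ⟨k + 1, f, gs, hv, ?_⟩
      have h1 := (rEq_delta_comm (hM := hM) hw.1.1 b true).append [] y
      have h2 := h.append (ab true true M) []
      simp only [List.nil_append, List.append_nil, ← List.append_assoc] at h1 h2
      exact h1.trans h2
    · have hs : Short M w := by
        refine ⟨.of_positive hw, fun b σ h => ?_⟩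
        have : (b, σ) ∈ w := h.subset (by
          obtain ⟨m, rfl⟩ := Nat.exists_eq_add_of_le' hM
          simp [ab])
        obtain rfl : σ = true := hw _ this
        exact hb ⟨b, h⟩
      obtain ⟨f, gs, ms, hv, hl, rfl⟩ := hs.exists_blocks hM
      refine ⟨0, f, gs, hv, ?_⟩
      rw [← blocks_signs hv hl hw]
      exact .refl

theorem validState_init (k : ℤ) (e : Bool) : ValidState M (mkState k e []) :=
  validState_mkState.2 (by simp)

theorem mkState_inj {k k' : ℤ} {e e' : Bool} {R R' : List ℕ}
    (h : mkState k e R = mkState k' e' R') : k = k' ∧ R = R' ∧ (R ≠ [] → e = e') := by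
  simp only [mkState, Prod.mk.injEq] at h
  obtain ⟨h1, h2, rfl⟩ := h
  exact ⟨h1, rfl, fun hR => by simpa [hR] using h2⟩

theorem blocks_nil (f : Bool) (ms : List Bool) : blocks M f [] ms = [] := by
  cases ms <;> rfl

theorem rEq_of_positive {w w' : Word Bool} (hw : Positive w) (hw' : Positive w')
    (h : wbar (dih M hM) w = wbar (dih M hM) w') : REq (dih M hM) w w' := by
  obtain ⟨k, f, gs, hv, h1⟩ := positive_normal_form hM w hw
  obtain ⟨k', f', gs', hv', h2⟩ := positive_normal_form hM w' hw'
  have := run_eq ((h1.wbar_eq.symm.trans h).trans h2.wbar_eq) (validState_init 0 f)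
  rw [run_append, run_append, run_garsidePow hM, run_garsidePow hM, mkState_nil (0 + (k' : ℤ)) f f',
    run_blocks hv (by simp), run_blocks hv' (by simp)] at this
  obtain ⟨e1, e2, e3⟩ := mkState_inj this
  simp only [List.count_replicate, List.append_nil, List.reverse_inj] at e1 e2
  subst e2
  obtain rfl : k = k' := by simpa using e1
  refine h1.trans (REq.symm ?_)
  by_cases hg : gs = []
  · subst hg
    rw [blocks_nil] at h1 ⊢
    rw [blocks_nil] at h2
    exact h2
  · rwa [← blocksEnd_inj (e3 (by simpa using hg))] at h2

theorem run_blocks_eq {f f' : Bool} {gs gs' : List ℕ} {ms ms' : List Bool}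
    (hv : ValidSizes M gs) (hv' : ValidSizes M gs') (hl : gs.length = ms.length)
    (hl' : gs'.length = ms'.length)
    (h : wbar (dih M hM) (blocks M f gs ms) = wbar (dih M hM) (blocks M f' gs' ms')) :
    gs = gs' ∧ ms ~ ms' ∧ (gs ≠ [] → blocksEnd M f gs ms = blocksEnd M f' gs' ms') := by
  have := run_eq h (validState_init 0 f)
  rw [run_blocks hv hl, mkState_nil 0 f f', run_blocks hv' hl'] at this
  obtain ⟨e1, e2, e3⟩ := mkState_inj this
  simp only [List.append_nil, List.reverse_inj] at e2
  subst e2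
  refine ⟨rfl, ?_, fun hg => e3 (by simpa using hg)⟩
  have hc : ms.count false = ms'.count false := by omega
  have h1 := List.count_false_add_count_true ms
  have h2 := List.count_false_add_count_true ms'
  rw [List.perm_iff_count]
  rintro (_ | _)
  · exact hc
  · omega

theorem rEq_of_blocks {f f' : Bool} {gs gs' : List ℕ} {ms ms' : List Bool}
    (hv : ValidSizes M gs) (hv' : ValidSizes M gs') (hl : gs.length = ms.length)
    (hl' : gs'.length = ms'.length)
    (h : wbar (dih M hM) (blocks M f gs ms) = wbar (dih M hM) (blocks M f' gs' ms')) :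
    REq (dih M hM) (blocks M f gs ms) (blocks M f' gs' ms') := by
  obtain ⟨rfl, hp, he⟩ := run_blocks_eq hv hv' hl hl' h
  by_cases hg : gs = []
  · subst hg; rw [blocks_nil, blocks_nil]; exact .refl
  · obtain ⟨h1, h2⟩ := blocks_perm (hM := hM) hp (f := f) hv hl
    rwa [← blocksEnd_inj (h2.symm.trans (he hg))]

theorem dih_rEq {w w' : Word Bool} (hw : Geodesic (dih M hM) w) (hw' : Geodesic (dih M hM) w')
    (h : wbar (dih M hM) w = wbar (dih M hM) w') : REq (dih M hM) w w' := by
  by_cases hp : Positive w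
  · exact rEq_of_positive hp (hw.positive_congr hw' h hp) h
  by_cases hn : Negative w
  · have := rEq_of_positive (hM := hM) (positive_wordInv.2 hn)
      (positive_wordInv.2 (hw.negative_congr hw' h hn)) (by rw [wbar_wordInv, h, wbar_wordInv])
    simpa only [wordInv_wordInv] using this.wordInv
  obtain ⟨f, gs, ms, hv, hl, rfl⟩ := (hw.short hp hn).exists_blocks hM
  obtain ⟨f', gs', ms', hv', hl', rfl⟩ := (hw'.short
    (fun h' => hp (hw'.positive_congr hw h.symm h'))
    (fun h' => hn (hw'.negative_congr hw h.symm h'))).exists_blocks hM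
  exact rEq_of_blocks hv hv' hl hl' h

theorem dih_no_inverse_ends {d d' : Word Bool} {b σ : Bool}
    (hw : Geodesic (dih M hM) (d ++ [(b, σ)])) (hw' : Geodesic (dih M hM) (d' ++ [(b, !σ)]))
    (h : wbar (dih M hM) (d ++ [(b, σ)]) = wbar (dih M hM) (d' ++ [(b, !σ)])) : False := by
  by_cases hp : Positive (d ++ [(b, σ)])
  · have h1 := hp (b, σ) (by simp)
    have h2 := hw.positive_congr hw' h hp (b, !σ) (by simp)
    simp_all
  by_cases hn : Negative (d ++ [(b, σ)])
  · have h1 := hn (b, σ) (by simp)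
    have h2 := hw.negative_congr hw' h hn (b, !σ) (by simp)
    simp_all
  obtain ⟨f, gs, ms, hv, hl, e⟩ := (hw.short hp hn).exists_blocks hM
  obtain ⟨f', gs', ms', hv', hl', e'⟩ := (hw'.short
    (fun h' => hp (hw'.positive_congr hw h.symm h'))
    (fun h' => hn (hw'.negative_congr hw h.symm h'))).exists_blocks hM
  rw [e, e'] at h
  obtain ⟨rfl, hp, he⟩ := run_blocks_eq hv hv' hl hl' h
  have l1 := blocks_last (f := f) (b := b) (σ := σ) (ms := ms) hv (by rw [← e]; simp)
  have l2 := blocks_last (f := f') (b := b) (σ := !σ) (ms := ms') hv (by rw [← e']; simp)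
  have := (l1.2.symm.trans (he l1.1)).trans l2.2
  cases σ <;> cases b <;> simp at this

end dihGroup

section dihGroup

variable {M : ℕ} {hM : 2 ≤ M}

theorem actP_mono (b : Bool) {y : ℤ × Bool × List ℕ} (hy : ValidState M y) :
    y.1 ≤ (actP M b y).1 := by
  obtain ⟨k, e, R, rfl, hR⟩ := hy.exists_eq
  rcases mkState_cases e b R k with h | ⟨g, R, rfl, rfl⟩
  · rw [h, actP_same]; simp [mkState]
  · rw [actP_diff]; split_ifs <;> simp [mkState]

theorem run_mono (hM : 2 ≤ M) {w : Word Bool} (hw : Positive w) {y : ℤ × Bool × List ℕ}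
    (hy : ValidState M y) : y.1 ≤ (run M w y).1 := by
  induction w generalizing y with
  | nil => exact le_rfl
  | cons l w ih =>
    obtain ⟨b, σ⟩ := l
    obtain rfl : σ = true := hw (b, σ) (by simp)
    rw [run_cons_true]
    exact (actP_mono b hy).trans (ih (fun l hl => hw l (by simp [hl])) (actP_valid hM b hy).1)

theorem run_pos_of_delta (hM : 2 ≤ M) {w : Word Bool} (hw : Positive w) {b : Bool}
    (hb : ab b true M <:+: w) {y : ℤ × Bool × List ℕ} (hy : ValidState M y) :
    y.1 < (run M w y).1 := by
  obtain ⟨p, q, rfl⟩ := hb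
  rw [positive_append, positive_append] at hw
  have h1 := run_mono hM hw.1.1 hy
  have h2 := run_valid hM p hy
  obtain ⟨k, e, R, h, hR⟩ := h2.exists_eq
  have h3 : (run M p y).1 < (run M (ab b true M) (run M p y)).1 := by
    rw [h, run_delta hM _ _ _ hR]; simp [mkState]
  have h4 := run_mono hM hw.2 (run_valid hM (ab b true M) h2)
  rw [run_append, run_append]
  omega

theorem Short.no_delta {w w' : Word Bool} (hw : Short M w)
    (h : wbar (dih M hM) w = wbar (dih M hM) w') (hp : Positive w') (b : Bool) :
    ¬ ab b true M <:+: w' := by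
  intro hb
  obtain ⟨f, gs, ms, hv, hl, rfl⟩ := hw.exists_blocks hM
  have h1 := run_pos_of_delta hM hp hb (validState_init (M := M) 0 f)
  rw [← run_eq h (validState_init 0 f), run_blocks hv hl] at h1
  simp [mkState] at h1
  omega

theorem Short.congr {w w' : Word Bool} (hw : Short M w) (hg : Geodesic (dih M hM) w')
    (h : wbar (dih M hM) w = wbar (dih M hM) w') : Short M w' := by
  refine ⟨hg.freelyReduced, fun b σ hb => ?_⟩
  cases σ
  · obtain ⟨c, hc⟩ := infix_ab_wordInv hM hb
    exact (hw.wordInv hM).no_delta (hM := hM) (by rw [wbar_wordInv, h, wbar_wordInv])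
      (positive_wordInv.2 (hg.negative_of_delta hb)) c hc
  · exact hw.no_delta h (hg.positive_of_delta hb) b hb

theorem length_le_sum_blockLen {gs : List ℕ} {ms : List Bool} (hv : ValidSizes M gs)
    (hl : gs.length = ms.length) : gs.length ≤ (List.zipWith (blockLen M) ms gs).sum := by
  induction gs generalizing ms with
  | nil => simp
  | cons g gs ih =>
    cases ms with
    | nil => simp at hl
    | cons σ ms =>
      rw [validSizes_cons] at hv
      have := ih hv.2 (by simpa using hl)
      have := blockLen_pos (σ := σ) hv.1
      simp; omega

theorem signs_unique (hM3 : 3 ≤ M) {gs : List ℕ} {ms ms' : List Bool} (hv : ValidSizes M gs)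
    (hl : gs.length = ms.length) (hl' : gs.length = ms'.length)
    (h : (List.zipWith (blockLen M) ms gs).sum = gs.length)
    (h' : (List.zipWith (blockLen M) ms' gs).sum = gs.length) : ms = ms' := by
  induction gs generalizing ms ms' with
  | nil => rw [List.length_eq_zero_iff.1 hl.symm, List.length_eq_zero_iff.1 hl'.symm]
  | cons g gs ih =>
    match ms, ms', hl, hl' with
    | σ :: ms, τ :: ms', hl, hl' =>
      rw [validSizes_cons] at hv
      simp only [List.length_cons, Nat.add_right_cancel_iff] at hl hl'
      have a1 := length_le_sum_blockLen hv.2 hl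
      have a2 := length_le_sum_blockLen hv.2 hl'
      have b1 := blockLen_pos (σ := σ) hv.1
      have b2 := blockLen_pos (σ := τ) hv.1
      simp only [List.zipWith_cons_cons, List.sum_cons, List.length_cons] at h h'
      rw [ih hv.2 hl hl' (by omega) (by omega)]
      have c1 : blockLen M σ g = 1 := by omega
      have c2 : blockLen M τ g = 1 := by omega
      cases σ <;> cases τ <;> simp [blockLen] at c1 c2 ⊢ <;> omega

theorem sum_blockLen_eq {f : Bool} {gs : List ℕ} {ms : List Bool} (hv : ValidSizes M gs)
    (hl : gs.length = ms.length)
    (h : ∀ b σ, ¬ [(b, σ), (!b, σ)] <+ blocks M f gs ms) :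
    (List.zipWith (blockLen M) ms gs).sum = gs.length := by
  induction gs generalizing f ms with
  | nil => simp
  | cons g gs ih =>
    cases ms with
    | nil => simp at hl
    | cons σ ms =>
      rw [validSizes_cons] at hv
      have h1 := ih hv.2 (by simpa using hl) fun b τ hb =>
        h b τ (hb.trans (List.sublist_append_right _ _))
      have h2 := blockLen_pos (σ := σ) hv.1
      have h3 : blockLen M σ g = 1 := by
        by_contra hne
        obtain ⟨n, hn⟩ : ∃ n, blockLen M σ g = n + 2 := ⟨blockLen M σ g - 2, by omega⟩
        apply h (if σ then f else !f) σ
        rw [blocks, hn, ab, ab]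
        simp
      simp only [List.zipWith_cons_cons, List.sum_cons, List.length_cons]
      omega

theorem two_syllable_unique (hM3 : 3 ≤ M) {c a : Bool × Bool} (hca : c.1 ≠ a.1) {w w' : Word Bool}
    (hw : w.Pairwise fun x y => x = y ∨ (x = c ∧ y = a)) (hmem : ∀ l ∈ w, l = c ∨ l = a)
    (hg : Geodesic (dih M hM) w) (hg' : Geodesic (dih M hM) w')
    (h : wbar (dih M hM) w = wbar (dih M hM) w') : w = w' := by
  have hs : Short M w := by
    refine ⟨hg.freelyReduced, fun b σ hb => ?_⟩
    obtain ⟨m, rfl⟩ := Nat.exists_eq_add_of_le' hM3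
    have h1 : [(b, σ), (!b, σ), (b, σ)] <+ ab b σ (m + 3) := by
      simp [ab]
    have := hw.sublist (h1.trans hb.sublist)
    simp at this
    obtain ⟨⟨h1, -⟩, h3, h4⟩ := this
    simp [← h1, ← h4] at hca
  have hs' := hs.congr hg' h
  obtain ⟨f, gs, ms, hv, hl, rfl⟩ := hs.exists_blocks hM
  obtain ⟨f', gs', ms', hv', hl', rfl⟩ := hs'.exists_blocks hM
  obtain ⟨rfl, hp, he⟩ := run_blocks_eq hv hv' hl hl' h
  have hms : ms = ms' := by
    by_cases hpos : ∃ τ, ∀ l ∈ blocks M f gs ms, l.2 = τ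
    · obtain ⟨τ, hτ⟩ := hpos
      have := blocks_signs hv hl hτ
      rw [this] at hp ⊢
      exact (List.perm_replicate.1 hp.symm).symm
    · have hne : c.2 ≠ a.2 := by
        intro hne
        refine hpos ⟨a.2, fun l hl => ?_⟩
        rcases hmem l hl with rfl | rfl
        · exact hne
        · rfl
      have h1 := sum_blockLen_eq hv hl fun b σ hb => by
        have := hw.sublist hb
        simp at this
        rw [← this.1, ← this.2] at hne
        exact hne rfl
      refine signs_unique hM3 hv hl hl' h1 ?_
      rw [← blocks_length f', ← hg.length_eq hg' h, blocks_length, h1]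
  subst hms
  by_cases hgs : gs = []
  · subst hgs; rw [blocks_nil, blocks_nil]
  · rw [blocksEnd_inj (he hgs)]

theorem exists_replicate_suffix {α : Type*} (w : List α) (a : α) :
    ∃ K x, w = x ++ List.replicate K a ∧ (x = [] ∨ ∃ y b, x = y ++ [b] ∧ b ≠ a) := by
  induction w using List.reverseRecOn with
  | nil => exact ⟨0, [], by simp, Or.inl rfl⟩
  | append_singleton w c ih =>
    by_cases h : c = a
    · subst h
      obtain ⟨K, x, rfl, hx⟩ := ih
      exact ⟨K + 1, x, by rw [List.replicate_succ', List.append_assoc], hx⟩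
    · exact ⟨0, w ++ [c], by simp, Or.inr ⟨w, c, rfl, h⟩⟩

theorem FreelyReduced.fst_ne {x y : Word S} {a b : S × Bool}
    (h : FreelyReduced (x ++ [a] ++ [b] ++ y)) (hab : a ≠ b) : a.1 ≠ b.1 := by
  intro e
  rcases eq_or_eq_linv e with rfl | rfl
  · exact hab rfl
  · exact h x y b.1 (!b.2) (by simp [linv])

theorem dih_two_ends (hM3 : 3 ≤ M) {d d' : Word Bool} {a b : Bool × Bool} (hab : a.1 ≠ b.1)
    (hw : Geodesic (dih M hM) (d ++ [a])) (hw' : Geodesic (dih M hM) (d' ++ [b]))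
    (h : wbar (dih M hM) (d ++ [a]) = wbar (dih M hM) (d' ++ [b])) :
    ∃ g a' b' l K, d = g ++ [a'] ++ List.replicate (l + 1) b' ++ List.replicate K a ∧
      a'.1 = a.1 ∧ b'.1 = b.1 := by
  have hex : ∀ c : Bool × Bool, c.1 ≠ a.1 → ∀ l K, d ≠ List.replicate l c ++ List.replicate K a := by
    rintro c hc l K rfl
    have hpw : (List.replicate l c ++ List.replicate K a ++ [a]).Pairwise
        fun x y => x = y ∨ (x = c ∧ y = a) := by
      rw [List.append_assoc, ← List.replicate_succ', List.pairwise_append]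
      simp only [List.pairwise_replicate, List.mem_replicate]
      exact ⟨by simp, by simp, fun x hx y hy => Or.inr ⟨hx.2, hy.2⟩⟩
    have := two_syllable_unique hM3 hc hpw (by simp [List.mem_replicate]; tauto) hw hw' h
    have := List.append_inj_right' this rfl
    simp only [List.cons.injEq, and_true] at this
    exact hab (congrArg Prod.fst this)
  obtain ⟨K, x, hd, rfl | ⟨y, b', rfl, hb'⟩⟩ := exists_replicate_suffix d a
  · exact absurd hd (hex (!a.1, true) (by simp) 0 K)
  have hfr := hw.freelyReduced
  have hb1 : b'.1 ≠ a.1 := by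
    refine FreelyReduced.fst_ne (x := y) (y := List.replicate K a) ?_ hb'
    have : d ++ [a] = y ++ [b'] ++ [a] ++ List.replicate K a := by
      rw [hd, List.append_assoc, ← List.replicate_succ', List.replicate_succ]; simp
    rwa [this] at hfr
  obtain ⟨l, z, hz, rfl | ⟨g, a', rfl, ha'⟩⟩ := exists_replicate_suffix y b'
  · refine absurd ?_ (hex b' hb1 (l + 1) K)
    rw [hd, hz, List.replicate_succ']; simp
  have hd' : d = g ++ [a'] ++ List.replicate (l + 1) b' ++ List.replicate K a := by
    rw [hd, hz, List.replicate_succ']; simp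
  have ha1 : a'.1 ≠ b'.1 := by
    refine FreelyReduced.fst_ne (x := g) (y := List.replicate l b' ++ List.replicate (K + 1) a) ?_ ha'
    have : d ++ [a] = g ++ [a'] ++ [b'] ++ (List.replicate l b' ++ List.replicate (K + 1) a) := by
      rw [hd', List.replicate_succ, List.replicate_succ']; simp
    rwa [this] at hfr
  refine ⟨g, a', b', l, K, hd', ?_, ?_⟩
  · revert ha1 hb1; cases a'.1 <;> cases b'.1 <;> cases a.1 <;> simp
  · revert hb1 hab; cases b.1 <;> cases b'.1 <;> cases a.1 <;> simp

end dihGroup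

/-! ### Parabolic subgroups on pairs of generators -/

/-- The relations of `A` between elements of `T` only, on the full set of generators. -/
noncomputable def ArtinData.on (A : ArtinData S) (T : Set S) : ArtinData S where
  m x y := if x ∈ T ∧ y ∈ T then A.m x y else ⊤
  symm x y := by simp only [A.symm x y, and_comm]
  two_le x y h := by
    split_ifs
    · exact A.two_le x y h
    · exact le_top

/-- A pair of generators with a finite label. -/
def IsPair (A : ArtinData S) (T : Set S) : Prop :=
  ∃ (s t : S) (M : ℕ), s ≠ t ∧ T = {s, t} ∧ A.m s t = (M : ℕ∞)

/-- Words over `T` which are geodesic for the relations in `T`. -/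
def Geo (A : ArtinData S) (T : Set S) (d : Word S) : Prop := GeodesicOver (A.on T) T d

/-- The element represented by a word for the relations in `T`. -/
noncomputable def val (A : ArtinData S) (T : Set S) (d : Word S) : ArtinGroup (A.on T) :=
  wbar (A.on T) d

section pair

variable {A : ArtinData S} {T : Set S}

theorem isRel_on {u v : Word S} (h : IsRel (A.on T) u v) :
    ∃ (x y : S) (k : ℕ), x ≠ y ∧ x ∈ T ∧ y ∈ T ∧ A.m x y = (k : ℕ∞) ∧
      u = altWord x y k ∧ v = altWord y x k := by
  obtain ⟨x, y, k, hxy, hk, hu, hv⟩ := h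
  simp only [ArtinData.on] at hk
  split_ifs at hk with hT
  · exact ⟨x, y, k, hxy, hT.1, hT.2, hk, hu, hv⟩
  · exact absurd hk.symm (ENat.natCast_ne_top k)

theorem val_append (u v : Word S) : val A T (u ++ v) = val A T u * val A T v :=
  wbar_append _ _ _

theorem altWord_map {S' : Type*} (f : S → S') (x y : S) (n : ℕ) :
    (altWord x y n).map (fun l => (f l.1, l.2)) = altWord (f x) (f y) n := by
  induction n generalizing x y with
  | zero => rfl
  | succ n ih => simp [altWord, ih]

theorem wordInv_map {S' : Type*} (f : S → S') (w : Word S) :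
    wordInv (w.map fun l => (f l.1, l.2)) = (wordInv w).map fun l => (f l.1, l.2) := by
  simp [wordInv, List.map_reverse, Function.comp_def]

/-- The word on the pair `s, t` corresponding to a word on the booleans. -/
def embWord (s t : S) (w : Word Bool) : Word S := w.map fun l => (cond l.1 t s, l.2)

/-- The word on the booleans corresponding to a word on a pair containing `t`. -/
noncomputable def pullWord (t : S) (w : Word S) : Word Bool :=
  w.map fun l => (decide (l.1 = t), l.2)

theorem embWord_append (s t : S) (u v : Word Bool) :
    embWord s t (u ++ v) = embWord s t u ++ embWord s t v := by simp [embWord]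

theorem pullWord_append (t : S) (u v : Word S) :
    pullWord t (u ++ v) = pullWord t u ++ pullWord t v := by simp [pullWord]

theorem embWord_length (s t : S) (u : Word Bool) : (embWord s t u).length = u.length := by
  simp [embWord]

theorem pullWord_length (t : S) (u : Word S) : (pullWord t u).length = u.length := by
  simp [pullWord]

theorem embWord_pullWord {s t : S} {w : Word S} (hw : WordOver {s, t} w) :
    embWord s t (pullWord t w) = w := by
  simp only [embWord, pullWord, List.map_map]
  rw [List.map_congr_left (g := id), List.map_id]
  rintro ⟨x, σ⟩ hx
  have := hw _ hx
  simp only [Set.mem_insert_iff, Set.mem_singleton_iff] at this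
  by_cases h : x = t
  · simp [h]
  · obtain rfl := this.resolve_right h
    simp [h]

theorem wordOver_embWord (s t : S) (w : Word Bool) : WordOver {s, t} (embWord s t w) := by
  intro l hl
  simp only [embWord, List.mem_map] at hl
  obtain ⟨⟨x, σ⟩, -, rfl⟩ := hl
  cases x <;> simp

section

variable {s t : S} {M : ℕ} {hM : 2 ≤ M}

theorem isRel_embWord (hst : s ≠ t) (hm : A.m s t = (M : ℕ∞)) {u v : Word Bool}
    (h : IsRel (dih M hM) u v) : IsRel A (embWord s t u) (embWord s t v) := by
  rw [isRel_dih] at h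
  obtain ⟨b, rfl, rfl⟩ := h
  have e := altWord_bool b M
  have e' := altWord_bool (!b) M
  rw [Bool.not_not] at e'
  rw [← e, ← e']
  simp only [embWord]
  rw [altWord_map (fun b => cond b t s), altWord_map (fun b => cond b t s)]
  cases b
  · exact ⟨s, t, M, hst, hm, rfl, rfl⟩
  · exact ⟨t, s, M, hst.symm, by rw [A.symm, hm], rfl, rfl⟩

theorem on_pair_m (hm : A.m s t = (M : ℕ∞)) : (A.on {s, t}).m s t = (M : ℕ∞) := by
  simp [ArtinData.on, hm]

theorem val_embWord (hst : s ≠ t) (hm : A.m s t = (M : ℕ∞)) {u v : Word Bool}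
    (h : wbar (dih M hM) u = wbar (dih M hM) v) :
    val A {s, t} (embWord s t u) = val A {s, t} (embWord s t v) :=
  wbar_map (A' := A.on {s, t}) (fun b => cond b t s)
    (fun _ _ huv => (isRel_embWord hst (on_pair_m hm) huv).wbar_eq) h

theorem wbar_pullWord (hst : s ≠ t) (hm : A.m s t = (M : ℕ∞)) {u v : Word S}
    (h : val A {s, t} u = val A {s, t} v) :
    wbar (dih M hM) (pullWord t u) = wbar (dih M hM) (pullWord t v) := by
  refine wbar_map (A := A.on {s, t}) (fun x => decide (x = t)) (fun u v huv => ?_) h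
  obtain ⟨x, y, k, hxy, hx, hy, hk, rfl, rfl⟩ := isRel_on huv
  rw [altWord_map (fun x => decide (x = t)), altWord_map (fun x => decide (x = t))]
  have hb : ∀ b : Bool, wbar (dih M hM) (altWord b (!b) M) = wbar (dih M hM) (altWord (!b) b M) := by
    intro b
    refine IsRel.wbar_eq (isRel_dih.2 ⟨b, altWord_bool b M, ?_⟩)
    have := altWord_bool (!b) M
    rwa [Bool.not_not] at this
  simp only [Set.mem_insert_iff, Set.mem_singleton_iff] at hx hy
  rcases hx with rfl | rfl <;> rcases hy with rfl | rfl
  · exact absurd rfl hxy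
  · rw [hm, Nat.cast_inj] at hk
    subst hk
    simpa [hst] using hb false
  · rw [A.symm, hm, Nat.cast_inj] at hk
    subst hk
    simpa [hst] using hb true
  · exact absurd rfl hxy

theorem Geo.geodesic_pullWord (hst : s ≠ t) (hm : A.m s t = (M : ℕ∞)) {d : Word S}
    (hd : Geo A {s, t} d) : Geodesic (dih M hM) (pullWord t d) := by
  intro w hw
  have := hd.2 (embWord s t w) (wordOver_embWord s t w) (by
    have := val_embWord hst hm hw
    rwa [embWord_pullWord hd.1] at this)
  rwa [embWord_length, ← pullWord_length t] at this

theorem embWord_rEq (hst : s ≠ t) (hm : A.m s t = (M : ℕ∞)) {u v : Word Bool}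
    (h : REq (dih M hM) u v) : REq A (embWord s t u) (embWord s t v) := by
  have hinv : ∀ w, wordInv (embWord s t w) = embWord s t (wordInv w) :=
    fun w => wordInv_map (fun b => cond b t s) w
  have hne : ∀ w, w ≠ [] → embWord s t w ≠ [] := by
    intro w hw; simpa [embWord] using hw
  have h2 : ∀ u v, Step2 (dih M hM) u v →
      Step2 A (embWord s t u) (embWord s t v) := by
    rintro u v (⟨x, y, u₁, u₂, v₁, v₂, huv, h1, h2, rfl, rfl⟩ |
      ⟨x, y, u₁, u₂, v₁, v₂, huv, h1, h2, rfl, rfl⟩)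
    all_goals
      have hr := isRel_embWord hst hm huv
      simp only [embWord_append] at hr
    · exact Or.inl ⟨embWord s t x, embWord s t y, _, _, _, _, hr, hne _ h1, hne _ h2,
        by simp only [embWord_append, hinv], by simp only [embWord_append, hinv]⟩
    · exact Or.inr ⟨embWord s t x, embWord s t y, _, _, _, _, hr, hne _ h1, hne _ h2,
        by simp only [embWord_append, hinv], by simp only [embWord_append, hinv]⟩
  refine Relation.ReflTransGen.lift (embWord s t) (fun u v huv => ?_) _ _ h
  refine Or.imp ?_ (fun h => ⟨h2 _ _ h.1, h2 _ _ h.2⟩) huv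
  rintro ⟨x, y, u, v, huv, h⟩
  refine ⟨embWord s t x, embWord s t y, _, _, isRel_embWord hst hm huv, h.imp ?_ ?_⟩
  · rintro ⟨rfl, rfl⟩
    exact ⟨by simp only [embWord_append], by simp only [embWord_append]⟩
  · rintro ⟨rfl, rfl⟩
    exact ⟨by simp only [embWord_append, hinv], by simp only [embWord_append, hinv]⟩

end

variable (hT : IsPair A T)
include hT

theorem Geo.rEq {d d' : Word S} (hd : Geo A T d) (hd' : Geo A T d')
    (h : val A T d = val A T d') : REq A d d' := by
  obtain ⟨s, t, M, hst, rfl, hm⟩ := hT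
  have hM : 2 ≤ M := by
    have := A.two_le s t hst
    rw [hm] at this
    exact_mod_cast this
  have := dih_rEq (hM := hM) (hd.geodesic_pullWord hst hm) (hd'.geodesic_pullWord hst hm)
    (wbar_pullWord hst hm h)
  have := embWord_rEq hst hm this
  rwa [embWord_pullWord hd.1, embWord_pullWord hd'.1] at this

theorem Geo.no_inverse_ends {d d' : Word S} {a : S × Bool} (hd : Geo A T (d ++ [a]))
    (hd' : Geo A T (d' ++ [linv a])) : val A T (d ++ [a]) ≠ val A T (d' ++ [linv a]) := by
  intro h
  obtain ⟨s, t, M, hst, rfl, hm⟩ := hT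
  have hM : 2 ≤ M := by
    have := A.two_le s t hst
    rw [hm] at this
    exact_mod_cast this
  have h1 := hd.geodesic_pullWord (hM := hM) hst hm
  have h2 := hd'.geodesic_pullWord (hM := hM) hst hm
  have h3 := wbar_pullWord (hM := hM) hst hm h
  rw [pullWord_append] at h1 h2 h3
  rw [pullWord_append] at h3
  exact dih_no_inverse_ends h1 h2 h3

theorem Geo.two_ends (hl : ∀ s t : S, s ≠ t → 3 ≤ A.m s t) {d d' : Word S} {a b : S × Bool}
    (hab : a.1 ≠ b.1) (hd : Geo A T (d ++ [a])) (hd' : Geo A T (d' ++ [b]))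
    (h : val A T (d ++ [a]) = val A T (d' ++ [b])) :
    ∃ g a' b' l K, d = g ++ [a'] ++ List.replicate (l + 1) b' ++ List.replicate K a ∧
      a'.1 = a.1 ∧ b'.1 = b.1 := by
  obtain ⟨s, t, M, hst, rfl, hm⟩ := hT
  have hM3 : 3 ≤ M := by
    have := hl s t hst
    rw [hm] at this
    exact_mod_cast this
  have hM : 2 ≤ M := by omega
  have h1 := hd.geodesic_pullWord (hM := hM) hst hm
  have h2 := hd'.geodesic_pullWord (hM := hM) hst hm
  have h3 := wbar_pullWord (hM := hM) hst hm h
  have hao := wordOver_append.1 hd.1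
  have hbo := wordOver_append.1 hd'.1
  have hd0 := embWord_pullWord hao.1
  have hae := embWord_pullWord hao.2
  have hbe := embWord_pullWord hbo.2
  rw [pullWord_append] at h1 h2 h3
  rw [pullWord_append] at h3
  have hab' : decide (a.1 = t) ≠ decide (b.1 = t) := by
    have h4 := wordOver_singleton.1 hao.2
    have h5 := wordOver_singleton.1 hbo.2
    simp only [Set.mem_insert_iff, Set.mem_singleton_iff] at h4 h5
    intro h6
    by_cases h7 : a.1 = t <;> by_cases h8 : b.1 = t <;> simp_all
  obtain ⟨g, a', b', l, K, hg, ha', hb'⟩ := dih_two_ends hM3 hab' h1 h2 h3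
  rw [hg] at hd0
  have hae' : (cond (decide (a.1 = t)) t s, a.2) = a := by
    simpa [embWord, pullWord] using hae
  have hbe' : (cond (decide (b.1 = t)) t s, b.2) = b := by
    simpa [embWord, pullWord] using hbe
  refine ⟨embWord s t g, (cond a'.1 t s, a'.2), (cond b'.1 t s, b'.2), l, K, ?_, ?_, ?_⟩
  · rw [← hd0]
    simp only [embWord_append]
    simp only [embWord, List.map_replicate, List.map_cons, List.map_nil, hae']
  · simp only [ha']
    exact congrArg Prod.fst hae'
  · simp only [hb']
    exact congrArg Prod.fst hbe'

end pair

section geo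

variable {A : ArtinData S} {T : Set S}

theorem Geo.length_eq {d d' : Word S} (hd : Geo A T d) (hd' : Geo A T d')
    (h : val A T d = val A T d') : d.length = d'.length :=
  (hd.2 d' hd'.1 h.symm).antisymm (hd'.2 d hd.1 h)

theorem Geo.left {d e : Word S} (h : Geo A T (d ++ e)) : Geo A T d := by
  have ho := wordOver_append.1 h.1
  refine ⟨ho.1, fun w hw he => ?_⟩
  have := h.2 (w ++ e) (wordOver_append.2 ⟨hw, ho.2⟩) (by rw [wbar_append, wbar_append, he])
  simpa using this

theorem Geo.congr {d d' : Word S} (hd : Geo A T d) (hd' : WordOver T d')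
    (h : val A T d = val A T d') (hl : d'.length ≤ d.length) : Geo A T d' :=
  ⟨hd', fun w hw he => hl.trans (hd.2 w hw (he.trans h.symm))⟩

theorem geo_nil : Geo A T [] := ⟨wordOver_nil, fun _ _ _ => Nat.zero_le _⟩

theorem exists_geo {g : Word S} (hg : WordOver T g) : ∃ d, Geo A T d ∧ val A T d = val A T g := by
  have hex : ∃ n, ∃ d : Word S, WordOver T d ∧ val A T d = val A T g ∧ d.length = n :=
    ⟨_, g, hg, rfl, rfl⟩
  obtain ⟨d, hd, he, hl⟩ := Nat.find_spec hex
  refine ⟨d, ⟨hd, fun w hw hwe => ?_⟩, he⟩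
  rw [hl]
  exact Nat.find_min' hex ⟨w, hw, Eq.trans hwe he, rfl⟩

theorem val_right_cancel {d d' e : Word S} (h : val A T (d ++ e) = val A T (d' ++ e)) :
    val A T d = val A T d' := by
  rw [val_append, val_append] at h
  exact mul_right_cancel h

theorem val_linv_cancel (d : Word S) (a : S × Bool) :
    val A T (d ++ [linv a] ++ [a]) = val A T d := by
  have := wbar_cancel (A.on T) (linv a)
  rw [linv_linv] at this
  rw [List.append_assoc, val_append]
  exact (congrArg _ this).trans (mul_one _)

theorem val_linv_cancel' (d : Word S) (a : S × Bool) :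
    val A T (d ++ [a] ++ [linv a]) = val A T d := by
  have := val_linv_cancel (A := A) (T := T) d (linv a)
  rwa [linv_linv] at this

theorem Geo.snoc_or {d : Word S} {c : S × Bool} (hd : Geo A T d) (hc : c.1 ∈ T) :
    Geo A T (d ++ [c]) ∨ ∃ e, Geo A T (e ++ [linv c]) ∧ val A T d = val A T (e ++ [linv c]) := by
  have ho : WordOver T (d ++ [c]) := wordOver_append.2 ⟨hd.1, wordOver_singleton.2 hc⟩
  obtain ⟨e, he, hv⟩ := exists_geo (A := A) ho
  have hp := parity_eq hv
  have he' : val A T d = val A T (e ++ [linv c]) := by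
    rw [val_append, hv, ← val_append, val_linv_cancel']
  have hoe : WordOver T (e ++ [linv c]) := wordOver_append.2 ⟨he.1, wordOver_singleton.2 hc⟩
  by_cases hl : (d ++ [c]).length ≤ e.length
  · exact Or.inl (he.congr ho hv hl)
  · refine Or.inr ⟨e, hd.congr hoe he' ?_, he'⟩
    simp only [List.length_append, List.length_singleton] at hl hp ⊢
    omega

theorem Geo.not_ends_inverse {d e : Word S} {c : S × Bool} (h : Geo A T (d ++ [c]))
    (he : Geo A T (e ++ [linv c])) : val A T d ≠ val A T (e ++ [linv c]) := by
  intro hv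
  have h1 := h.left.length_eq he hv
  have h2 := h.2 e he.left.1 (by
    have := val_linv_cancel (A := A) (T := T) e c
    rw [val_append, ← hv, ← val_append] at this
    exact this.symm)
  simp only [List.length_append, List.length_singleton] at h1 h2
  omega

theorem IsPair.eq_of_mem {T' : Set S} (hT : IsPair A T) (hT' : IsPair A T') {x y : S}
    (hxy : x ≠ y) (hx : x ∈ T) (hy : y ∈ T) (hx' : x ∈ T') (hy' : y ∈ T') : T = T' := by
  have key : ∀ {T : Set S}, IsPair A T → x ∈ T → y ∈ T → T = {x, y} := by
    rintro _ ⟨s, t, M, hst, rfl, -⟩ hx hy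
    simp only [Set.mem_insert_iff, Set.mem_singleton_iff] at hx hy
    rcases hx with rfl | rfl <;> rcases hy with rfl | rfl
    · exact absurd rfl hxy
    · rfl
    · exact Set.pair_comm _ _
    · exact absurd rfl hxy
  rw [key hT hx hy, key hT' hx' hy']

end geo

/-! ### Rewriting by geodesics on pairs of generators -/

/-- Replace a factor which is geodesic on a pair of generators by an equivalent one. -/
def Swap (A : ArtinData S) (w w' : Word S) : Prop :=
  ∃ (u v : Word S) (T : Set S) (d d' : Word S), IsPair A T ∧ Geo A T d ∧ Geo A T d' ∧
    val A T d = val A T d' ∧ w = u ++ d ++ v ∧ w' = u ++ d' ++ v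

/-- The equivalence relation generated by swaps. -/
def Eqv (A : ArtinData S) : Word S → Word S → Prop := Relation.ReflTransGen (Swap A)

/-- No word equivalent to `w` contains a letter followed by its inverse. -/
def Good (A : ArtinData S) (w : Word S) : Prop :=
  ∀ w', Eqv A w w' → ∀ u v a, w' ≠ u ++ [a, linv a] ++ v

/-- Some word equivalent to `w` ends with `a`. -/
def Ends (A : ArtinData S) (w : Word S) (a : S × Bool) : Prop := ∃ u, Eqv A w (u ++ [a])

/-- No word equivalent to `v` ends with a letter of `T`. -/
def RedT (A : ArtinData S) (T : Set S) (v : Word S) : Prop := ∀ a, a.1 ∈ T → ¬ Ends A v a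

/-- The word `u` is good, and the letter `a` does not cancel at its end. -/
def Extends (A : ArtinData S) (u : Word S) (a : S × Bool) : Prop := Good A u ∧ ¬ Ends A u (linv a)

section eqv

variable {A : ArtinData S} {T : Set S}

theorem Swap.symm {w w' : Word S} (h : Swap A w w') : Swap A w' w := by
  obtain ⟨u, v, T, d, d', hT, hd, hd', he, h, h'⟩ := h
  exact ⟨u, v, T, d', d, hT, hd', hd, he.symm, h', h⟩

theorem Swap.append {w w' : Word S} (x y : Word S) (h : Swap A w w') :
    Swap A (x ++ w ++ y) (x ++ w' ++ y) := by
  obtain ⟨u, v, T, d, d', hT, hd, hd', he, rfl, rfl⟩ := h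
  exact ⟨x ++ u, v ++ y, T, d, d', hT, hd, hd', he, by simp, by simp⟩

theorem Eqv.refl (w : Word S) : Eqv A w w := Relation.ReflTransGen.refl

theorem Eqv.trans {u v w : Word S} (h : Eqv A u v) (h' : Eqv A v w) : Eqv A u w :=
  Relation.ReflTransGen.trans h h'

theorem Eqv.symm {w w' : Word S} (h : Eqv A w w') : Eqv A w' w := by
  induction h with
  | refl => exact Eqv.refl _
  | tail _ h ih => exact Relation.ReflTransGen.head h.symm ih

theorem Eqv.append_right {w w' : Word S} (h : Eqv A w w') (y : Word S) :
    Eqv A (w ++ y) (w' ++ y) :=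
  Relation.ReflTransGen.lift (fun w => w ++ y)
    (fun _ _ h => by simpa using Swap.append [] y h) _ _ h

theorem Eqv.append_left {w w' : Word S} (h : Eqv A w w') (x : Word S) :
    Eqv A (x ++ w) (x ++ w') :=
  Relation.ReflTransGen.lift (fun w => x ++ w)
    (fun _ _ h => by simpa using Swap.append x [] h) _ _ h

theorem Eqv.length_eq {w w' : Word S} (h : Eqv A w w') : w.length = w'.length := by
  induction h with
  | refl => rfl
  | tail _ h ih =>
    obtain ⟨u, v, T, d, d', hT, hd, hd', he, rfl, rfl⟩ := h
    rw [ih]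
    simp [hd.length_eq hd' he]

theorem Eqv.rEq {w w' : Word S} (h : Eqv A w w') : REq A w w' := by
  induction h with
  | refl => exact Relation.ReflTransGen.refl
  | tail _ h ih =>
    obtain ⟨u, v, T, d, d', hT, hd, hd', he, rfl, rfl⟩ := h
    exact ih.trans ((hd.rEq hT hd' he).append u v)

theorem Geo.eqv {d d' : Word S} (hT : IsPair A T) (hd : Geo A T d) (hd' : Geo A T d')
    (h : val A T d = val A T d') : Eqv A d d' :=
  Relation.ReflTransGen.single ⟨[], [], T, d, d', hT, hd, hd', h, by simp, by simp⟩

theorem Good.congr {w w' : Word S} (hw : Good A w) (h : Eqv A w w') : Good A w' :=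
  fun _ h' => hw _ (h.trans h')

theorem Good.left {u v : Word S} (h : Good A (u ++ v)) : Good A u := by
  rintro w hw p q a rfl
  exact h _ (hw.append_right v) p (q ++ v) a (by simp)

theorem good_nil : Good A ([] : Word S) := by
  rintro w hw u v a rfl
  have := hw.length_eq
  simp at this

theorem Ends.congr {w w' : Word S} {a : S × Bool} (hw : Ends A w a) (h : Eqv A w w') :
    Ends A w' a := by
  obtain ⟨u, hu⟩ := hw
  exact ⟨u, h.symm.trans hu⟩

theorem Extends.congr {w w' : Word S} {a : S × Bool} (hw : Extends A w a) (h : Eqv A w w') :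
    Extends A w' a :=
  ⟨hw.1.congr h, fun he => hw.2 (he.congr h.symm)⟩

theorem Good.extends {u : Word S} {a : S × Bool} (h : Good A (u ++ [a])) : Extends A u a := by
  refine ⟨h.left, ?_⟩
  rintro ⟨v, hv⟩
  exact h _ (hv.append_right [a]) v [] (linv a) (by simp)

theorem geo_snoc {v d : Word S} {c : S × Bool} (hT : IsPair A T) (hd : Geo A T d) (hc : c.1 ∈ T)
    (h : ¬ Ends A (v ++ d) (linv c)) : Geo A T (d ++ [c]) := by
  refine (hd.snoc_or hc).resolve_right ?_
  rintro ⟨e, he, hv⟩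
  refine h ⟨v ++ e, ?_⟩
  rw [List.append_assoc]
  exact (hd.eqv hT he hv).append_left v

theorem Good.geo {x d : Word S} (hT : IsPair A T) (h : Good A (x ++ d)) (hd : WordOver T d) :
    Geo A T d := by
  induction d using List.reverseRecOn with
  | nil => exact geo_nil
  | append_singleton d c ih =>
    rw [← List.append_assoc] at h
    have ho := wordOver_append.1 hd
    exact geo_snoc hT (ih h.left ho.1) (wordOver_singleton.1 ho.2) h.extends.2

theorem Good.exists_decomp {u : Word S} (hT : IsPair A T) (hu : Good A u) :
    ∃ x f, Eqv A u (x ++ f) ∧ RedT A T x ∧ Geo A T f := by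
  suffices key : ∀ n (v f : Word S), v.length = n → Geo A T f → Good A (v ++ f) →
      ∃ x g, Eqv A (v ++ f) (x ++ g) ∧ RedT A T x ∧ Geo A T g by
    simpa using key _ u [] rfl geo_nil (by simpa using hu)
  intro n
  induction n with
  | zero =>
    intro v f hv hf _
    refine ⟨v, f, Eqv.refl _, ?_, hf⟩
    rintro a - ⟨u, hu⟩
    have := hu.length_eq
    simp [hv] at this
  | succ n ih =>
    intro v f hv hf hg
    by_cases hr : RedT A T v
    · exact ⟨v, f, Eqv.refl _, hr, hf⟩
    · simp only [RedT, not_forall, not_not] at hr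
      obtain ⟨a, ha, y, hy⟩ := hr
      have hvy : Eqv A (v ++ f) (y ++ ([a] ++ f)) := by
        simpa using hy.append_right f
      have hl := hy.length_eq
      simp only [List.length_append, List.length_singleton, hv, Nat.add_right_cancel_iff] at hl
      obtain ⟨x, g, h1, h2, h3⟩ := ih y ([a] ++ f) hl.symm
        ((hg.congr hvy).geo hT (wordOver_append.2 ⟨wordOver_singleton.2 ha, hf.1⟩)) (hg.congr hvy)
      exact ⟨x, g, hvy.trans h1, h2, h3⟩

end eqv

/-- The relation between `u, a` and `u', b` when the words `u a` and `u' b` are equivalent and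
good: either they end in the same letter, or they differ by a single swap at the end. -/
def LastSwap (A : ArtinData S) (u : Word S) (a : S × Bool) (u' : Word S) (b : S × Bool) : Prop :=
  (a = b ∧ Eqv A u u') ∨ ∃ (T : Set S) (v d d' : Word S), IsPair A T ∧ RedT A T v ∧
    Geo A T (d ++ [a]) ∧ Geo A T (d' ++ [b]) ∧ val A T (d ++ [a]) = val A T (d' ++ [b]) ∧
    a.1 ≠ b.1 ∧ Eqv A u (v ++ d) ∧ Eqv A u' (v ++ d')

/-- Equivalences between words obtained by adding a letter to words of length less than `n` which
it extends are governed by the last letter. -/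
def Ctrl (A : ArtinData S) (n : ℕ) : Prop :=
  ∀ u a, u.length < n → Extends A u a → ∀ w, Eqv A (u ++ [a]) w →
    ∃ u' b, w = u' ++ [b] ∧ Extends A u' b ∧ LastSwap A u a u' b

theorem replicate_add_split {α : Type*} (x : List α) (a : α) {k m n : ℕ} (h : n = k + m) :
    x ++ List.replicate n a = (x ++ List.replicate k a) ++ List.replicate m a := by
  rw [h, List.replicate_add, List.append_assoc]

section ctrl

variable {A : ArtinData S} {T : Set S} {n : ℕ}

theorem LastSwap.congr_right {u u₁ u₂ : Word S} {a b : S × Bool} (h : LastSwap A u a u₁ b)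
    (hu : Eqv A u₁ u₂) : LastSwap A u a u₂ b := by
  rcases h with ⟨hab, h⟩ | ⟨T, v, d, d', hT, hv, h1, h2, h3, h4, h5, h6⟩
  · exact Or.inl ⟨hab, h.trans hu⟩
  · exact Or.inr ⟨T, v, d, d', hT, hv, h1, h2, h3, h4, h5, hu.symm.trans h6⟩

variable (H : Ctrl A n)
include H

theorem Ctrl.good_snoc {u : Word S} {a : S × Bool} (hn : u.length < n) (h : Extends A u a) :
    Good A (u ++ [a]) := by
  rintro w hw p q c rfl
  obtain ⟨u', b, he, hb, -⟩ := H u a hn h _ hw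
  rcases List.eq_nil_or_concat q with rfl | ⟨q', b', rfl⟩
  · have he' : (p ++ [c]) ++ [linv c] = u' ++ [b] := by simpa using he
    obtain ⟨h1, h2⟩ := List.append_inj' he' rfl
    simp only [List.cons.injEq, and_true] at h2
    refine hb.2 ⟨p, ?_⟩
    rw [← h1, ← h2, linv_linv]
    exact Eqv.refl _
  · have he' : (p ++ [c, linv c] ++ q') ++ [b'] = u' ++ [b] := by simpa using he
    exact hb.1 u' (Eqv.refl _) p q' c (List.append_inj' he' rfl).1.symm

theorem Ctrl.lastSwap {u u' : Word S} {a b : S × Bool} (hn : u.length < n)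
    (h : Good A (u ++ [a])) (he : Eqv A (u ++ [a]) (u' ++ [b])) : LastSwap A u a u' b := by
  obtain ⟨u₁, b₁, h1, -, h2⟩ := H u a hn h.extends _ he
  obtain ⟨rfl, h4⟩ := List.append_inj' h1 rfl
  simp only [List.cons.injEq, and_true] at h4
  rwa [h4]

theorem Ctrl.cancel_letter {u u' : Word S} {a : S × Bool} (hn : u.length < n)
    (h : Good A (u ++ [a])) (he : Eqv A (u ++ [a]) (u' ++ [a])) : Eqv A u u' := by
  rcases H.lastSwap hn h he with ⟨-, h⟩ | ⟨T, v, d, d', -, -, -, -, -, h, -⟩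
  · exact h
  · exact absurd rfl h

theorem Ctrl.cancel {u u' p : Word S} (hn : (u ++ p).length ≤ n)
    (h : Good A (u ++ p)) (he : Eqv A (u ++ p) (u' ++ p)) : Eqv A u u' := by
  induction p using List.reverseRecOn with
  | nil => simpa using he
  | append_singleton p a ih =>
    rw [← List.append_assoc] at h hn he
    rw [← List.append_assoc] at he
    simp only [List.length_append, List.length_singleton] at hn ih
    exact ih (by omega) h.left (H.cancel_letter (by simp; omega) h he)

theorem Ctrl.two {u u' : Word S} {a b : S × Bool} (hn : u.length < n)
    (h : Good A (u ++ [a])) (he : Eqv A (u ++ [a]) (u' ++ [b])) (hab : a ≠ b) :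
    ∃ (T : Set S) (v d d' : Word S), IsPair A T ∧ RedT A T v ∧
      Geo A T (d ++ [a]) ∧ Geo A T (d' ++ [b]) ∧ val A T (d ++ [a]) = val A T (d' ++ [b]) ∧
      a.1 ≠ b.1 ∧ Eqv A u (v ++ d) ∧ Eqv A u' (v ++ d') :=
  (H.lastSwap hn h he).resolve_left fun h => hab h.1

theorem Ctrl.decomp_unique {v v' d d' : Word S} (hT : IsPair A T) (hn : (v ++ d).length ≤ n)
    (hg : Good A (v ++ d)) (he : Eqv A (v ++ d) (v' ++ d')) (hv : RedT A T v) (hv' : RedT A T v')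
    (hd : Geo A T d) (hd' : Geo A T d') : Eqv A v v' ∧ val A T d = val A T d' := by
  induction hk : d.length generalizing v v' d d' with
  | zero =>
    obtain rfl := List.length_eq_zero_iff.1 hk
    rcases List.eq_nil_or_concat d' with rfl | ⟨e, b, rfl⟩
    · exact ⟨by simpa using he, rfl⟩
    · refine absurd ⟨v' ++ e, ?_⟩ (hv b (hd'.1 b (by simp)))
      simpa using he
  | succ k ih =>
    rcases List.eq_nil_or_concat d with rfl | ⟨e, a, rfl⟩
    · simp at hk
    rw [List.concat_eq_append] at *
    have ha : a.1 ∈ T := hd.1 a (by simp)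
    rw [← List.append_assoc] at hg he hn
    simp only [List.length_append, List.length_singleton] at hn hk
    rcases List.eq_nil_or_concat d' with rfl | ⟨e', b, rfl⟩
    · refine absurd ⟨v ++ e, ?_⟩ (hv' a ha)
      simpa using he.symm
    rw [List.concat_eq_append] at *
    have hb : b.1 ∈ T := hd'.1 b (by simp)
    rw [← List.append_assoc v' e'] at he
    have hlt : (v ++ e).length < n := by simp; omega
    have hle : (v ++ e).length ≤ n := hlt.le
    have hek : e.length = k := by omega
    rcases H.lastSwap hlt hg he with ⟨rfl, h⟩ | ⟨T', x, f, f', hT', hx, h1, h2, h3, h4, h5, h6⟩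
    · obtain ⟨h1, h2⟩ := ih hle hg.left h hv hv' hd.left hd'.left hek
      exact ⟨h1, by rw [val_append, h2, ← val_append]⟩
    · obtain rfl : T' = T := hT'.eq_of_mem hT h4 (h1.1 a (by simp)) (h2.1 b (by simp)) ha hb
      obtain ⟨h7, h8⟩ := ih hle hg.left h5 hv hx hd.left h1.left hek
      have hl := hd.length_eq h1 (by rw [val_append, h8, ← val_append])
      have hl2 := h1.length_eq h2 h3
      have hl3 := he.length_eq
      have hl4 := h6.length_eq
      simp only [List.length_append, List.length_singleton] at hl hl2 hl3 hl4
      have hle' : (x ++ f').length ≤ n := by simp; omega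
      obtain ⟨h9, h10⟩ := ih hle' ((hg.congr he).left.congr h6) h6.symm hx hv' h2.left hd'.left
        (by omega)
      exact ⟨h7.trans h9, by rw [val_append, h8, ← val_append, h3, val_append, h10,
        ← val_append]⟩

theorem Ctrl.ends {v e : Word S} {c : S × Bool} (hT : IsPair A T) (hn : (v ++ e).length ≤ n)
    (hg : Good A (v ++ e)) (hv : RedT A T v) (he : Geo A T e) (hc : c.1 ∈ T)
    (h : Ends A (v ++ e) c) : ∃ e', Geo A T (e' ++ [c]) ∧ val A T e = val A T (e' ++ [c]) := by
  obtain ⟨y, hy⟩ := h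
  obtain ⟨x, f, h1, h2, h3⟩ := (hg.congr hy).left.exists_decomp hT
  have h4 : Eqv A (v ++ e) (x ++ (f ++ [c])) := by
    rw [← List.append_assoc]
    exact hy.trans (h1.append_right [c])
  have h5 : Geo A T (f ++ [c]) := (hg.congr h4).geo hT
    (wordOver_append.2 ⟨h3.1, wordOver_singleton.2 hc⟩)
  exact ⟨f, h5, (H.decomp_unique hT hn hg h4 hv h2 he h5).2⟩

theorem Ctrl.extends_of_good {v e : Word S} {c : S × Bool} (hT : IsPair A T)
    (hn : (v ++ e).length ≤ n) (hg : Good A (v ++ e)) (hv : RedT A T v)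
    (he : Geo A T (e ++ [c])) : Extends A (v ++ e) c := by
  refine ⟨hg, fun h => ?_⟩
  obtain ⟨e', h1, h2⟩ := H.ends (c := linv c) hT hn hg hv he.left (he.1 c (by simp)) h
  exact he.not_ends_inverse h1 h2

theorem Ctrl.good_append {v e : Word S} (hT : IsPair A T)
    (hn : (v ++ e).length ≤ n) (hg : Good A v) (hv : RedT A T v)
    (he : Geo A T e) : Good A (v ++ e) := by
  induction e using List.reverseRecOn with
  | nil => simpa using hg
  | append_singleton e c ih =>
    rw [← List.append_assoc] at hn ⊢
    have hn' : (v ++ e).length < n := by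
      simp only [List.length_append, List.length_singleton] at hn ⊢; omega
    exact H.good_snoc hn' (H.extends_of_good hT hn'.le (ih hn'.le he.left) hv he)

theorem Ctrl.extends_of_geo {v e : Word S} {c : S × Bool} (hT : IsPair A T)
    (hn : (v ++ e).length ≤ n) (hg : Good A v) (hv : RedT A T v)
    (he : Geo A T (e ++ [c])) : Extends A (v ++ e) c :=
  H.extends_of_good hT hn (H.good_append hT hn hg hv he.left) hv he

theorem Ctrl.three_ends (hl : ∀ s t : S, s ≠ t → 3 ≤ A.m s t) {C p q x : Word S}
    {a b c : S × Bool} {k : ℕ} (hn : C.length ≤ n) (hC : Good A C) (hp : Eqv A C (p ++ [a]))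
    (hq : Eqv A C (q ++ [b])) (hx : Eqv A C (x ++ [c] ++ List.replicate (k + 1) a))
    (hab : a.1 ≠ b.1) (hac : a.1 ≠ c.1) (hbc : b.1 ≠ c.1) : False := by
  induction hN : C.length using Nat.strong_induction_on generalizing C p q x a b c k with
  | _ N ih =>
  have hlp := hp.length_eq
  simp only [List.length_append, List.length_singleton] at hlp
  obtain ⟨T, v, d, d', hT, hv, h1, h2, h3, -, h5, -⟩ := H.two (by omega) (hC.congr hp)
    (hp.symm.trans hq) fun h => hab (congrArg Prod.fst h)
  obtain ⟨g, a', b', l, K, hd, ha', hb'⟩ := h1.two_ends hT hl hab h2 h3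
  have hC' : Eqv A C (v ++ g ++ [a'] ++ List.replicate (l + 1) b' ++
      List.replicate (K + 1) a) := by
    have := hp.trans (h5.append_right [a])
    rw [hd] at this
    simpa [List.replicate_succ'] using this
  have hlx := hx.length_eq
  have hlC := hC'.length_eq
  rcases lt_trichotomy k K with hkK | rfl | hkK
  · rw [replicate_add_split _ a (show K + 1 = (K - k) + (k + 1) by omega)] at hC'
    have h6 := H.cancel (by omega) (hC.congr hx) (hx.symm.trans hC')
    obtain ⟨m, hm⟩ : ∃ m, K - k = m + 1 := ⟨K - k - 1, by omega⟩
    rw [hm] at h6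
    refine ih _ ?_ ?_ (hC.congr hx).left (p := v ++ g ++ [a'] ++ List.replicate (l + 1) b' ++
      List.replicate m a) (b := c) (x := v ++ g ++ [a'] ++ List.replicate l b') (c := b')
      (k := m) ?_ (Eqv.refl _) ?_ hac (by rwa [hb']) (by rw [hb']; exact hbc.symm) rfl
    · rw [← hN, hlx]; simp
    · simp only [List.length_append, List.length_replicate] at hlx ⊢; omega
    · simpa [List.replicate_succ'] using h6
    · simpa [List.replicate_succ'] using h6
  · have h6 := H.cancel (by omega) (hC.congr hx) (hx.symm.trans hC')
    refine ih _ ?_ ?_ (hC.congr hx).left (p := v ++ g ++ [a'] ++ List.replicate l b')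
      (b := c) (x := v ++ g) (c := a') (k := l) ?_ (Eqv.refl _) h6
      (by rwa [hb']) (by rw [hb', ha']; exact hab.symm) (by rw [ha']; exact hac.symm) rfl
    · rw [← hN, hlx]; simp
    · simp only [List.length_append, List.length_replicate] at hlx ⊢; omega
    · simpa [List.replicate_succ'] using h6
  · rw [replicate_add_split _ a (show k + 1 = (k - K) + (K + 1) by omega)] at hx
    have hlx := hx.length_eq
    have h6 := H.cancel (by omega) (hC.congr hx) (hx.symm.trans hC')
    obtain ⟨m, hm⟩ : ∃ m, k - K = m + 1 := ⟨k - K - 1, by omega⟩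
    rw [hm] at h6 hx hlx
    refine ih _ ?_ ?_ (hC.congr hx).left (a := a) (p := x ++ [c] ++ List.replicate m a)
      (b := b') (q := v ++ g ++ [a'] ++ List.replicate l b') (x := x) (c := c) (k := m)
      ?_ ?_ (Eqv.refl _) (by rwa [hb']) hac (by rwa [hb']) rfl
    · rw [← hN, hlx]; simp
    · simp only [List.length_append, List.length_replicate] at hlx ⊢; omega
    · simpa [List.replicate_succ'] using Eqv.refl (A := A) _
    · simpa [List.replicate_succ'] using h6

theorem Ctrl.no_mixed (hl : ∀ s t : S, s ≠ t → 3 ≤ A.m s t) {u V W : Word S}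
    {a a' a'' b c : S × Bool} {l j K J : ℕ} (hn : u.length ≤ n) (hu : Good A u)
    (hV : Eqv A u (V ++ [a'] ++ List.replicate (l + 1) b ++ List.replicate K a))
    (hW : Eqv A u (W ++ [a''] ++ List.replicate (j + 1) c ++ List.replicate J a))
    (ha' : a'.1 = a.1) (ha'' : a''.1 = a.1) (hab : a.1 ≠ b.1) (hac : a.1 ≠ c.1)
    (hbc : b.1 ≠ c.1) : False := by
  wlog hKJ : K ≤ J generalizing V W a' a'' b c l j K J
  · exact this hW hV ha'' ha' hac hab hbc.symm (le_of_not_ge hKJ)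
  rw [replicate_add_split _ a (show J = (J - K) + K by omega)] at hW
  have hlV := hV.length_eq
  have h1 := H.cancel (by omega) (hu.congr hV) (hV.symm.trans hW)
  have hle : (V ++ [a'] ++ List.replicate (l + 1) b).length ≤ n := by
    rw [List.length_append] at hlV; omega
  have hb : Eqv A (V ++ [a'] ++ List.replicate (l + 1) b)
      (V ++ [a'] ++ List.replicate l b ++ [b]) := by
    simpa [List.replicate_succ'] using Eqv.refl (A := A) _
  rcases Nat.eq_zero_or_pos (J - K) with h0 | h0
  · rw [h0] at h1
    refine H.three_ends hl (a := b) (b := c) (c := a') (q := W ++ [a''] ++ List.replicate j c) hle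
      (hu.congr hV).left hb ?_ (Eqv.refl _) hbc
      (by rw [ha']; exact hab.symm) (by rw [ha']; exact hac.symm)
    simpa [List.replicate_succ'] using h1
  · obtain ⟨m, hm⟩ : ∃ m, J - K = m + 1 := ⟨J - K - 1, by omega⟩
    rw [hm] at h1
    refine H.three_ends hl (a := a) (b := b) (c := c)
      (p := W ++ [a''] ++ List.replicate (j + 1) c ++ List.replicate m a)
      (x := W ++ [a''] ++ List.replicate j c) (k := m) hle
      (hu.congr hV).left ?_ hb ?_ hab hac hbc
    · simpa [List.replicate_succ'] using h1
    · simpa [List.replicate_succ'] using h1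

end ctrl

section main

variable {A : ArtinData S} (hl : ∀ s t : S, s ≠ t → 3 ≤ A.m s t)
include hl

theorem Ctrl.swap_step {n : ℕ} (H : Ctrl A n) {u u₁ w : Word S} {a b : S × Bool}
    (hn : u₁.length ≤ n) (hb : Extends A u₁ b) (hq : LastSwap A u a u₁ b)
    (hs : Swap A (u₁ ++ [b]) w) :
    ∃ u₂ c, w = u₂ ++ [c] ∧ Extends A u₂ c ∧ LastSwap A u a u₂ c := by
  obtain ⟨x, y, T, d, d', hT, hd, hd', hv, he, rfl⟩ := hs
  have hld := hd.length_eq hd' hv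
  rcases List.eq_nil_or_concat y with rfl | ⟨y', b', rfl⟩
  swap
  · have he' : u₁ ++ [b] = (x ++ d ++ y') ++ [b'] := by simpa using he
    obtain ⟨rfl, h2⟩ := List.append_inj' he' rfl
    simp only [List.cons.injEq, and_true] at h2
    subst h2
    have h3 : Eqv A (x ++ d ++ y') (x ++ d' ++ y') :=
      Relation.ReflTransGen.single ⟨x, y', T, d, d', hT, hd, hd', hv, rfl, rfl⟩
    exact ⟨x ++ d' ++ y', b, by simp, hb.congr h3, hq.congr_right h3⟩
  rcases List.eq_nil_or_concat d with rfl | ⟨e, b', rfl⟩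
  · obtain rfl := List.length_eq_zero_iff.1 hld.symm
    exact ⟨u₁, b, he.symm, hb, hq⟩
  rcases List.eq_nil_or_concat d' with rfl | ⟨e', c, rfl⟩
  · simp at hld
  rw [List.concat_eq_append] at *
  rw [List.concat_eq_append] at *
  have he' : u₁ ++ [b] = (x ++ e) ++ [b'] := by simpa using he
  obtain ⟨rfl, h2⟩ := List.append_inj' he' rfl
  simp only [List.cons.injEq, and_true] at h2
  subst h2
  by_cases hbc : b = c
  · subst hbc
    have h3 : Eqv A (x ++ e) (x ++ e') :=
      (hd.left.eqv hT hd'.left (val_right_cancel hv)).append_left x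
    exact ⟨x ++ e', b, by simp, hb.congr h3, hq.congr_right h3⟩
  have hbc1 : b.1 ≠ c.1 := by
    intro h
    rcases eq_or_eq_linv h with h | h
    · exact hbc h
    · have hc : c = linv b := by rw [h, linv_linv]
      rw [hc] at hd' hv
      exact hd.no_inverse_ends hT hd' hv
  obtain ⟨x', f, hx, hr, hf⟩ := hb.1.left.exists_decomp hT
  have h1 : Eqv A (x ++ e) (x' ++ (f ++ e)) := by
    simpa using hx.append_right e
  have h1' : Eqv A (x ++ e') (x' ++ (f ++ e')) := by
    simpa using hx.append_right e'
  have hbT : b.1 ∈ T := hd.1 b (by simp)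
  have hcT : c.1 ∈ T := hd'.1 c (by simp)
  have hfe : Geo A T (f ++ e) :=
    (hb.1.congr h1).geo hT (wordOver_append.2 ⟨hf.1, hd.left.1⟩)
  have hD : Geo A T (f ++ e ++ [b]) := geo_snoc hT hfe hbT (hb.congr h1).2
  have hvD : val A T (f ++ e ++ [b]) = val A T (f ++ e' ++ [c]) := by
    rw [List.append_assoc, val_append, hv, ← val_append, List.append_assoc]
  have hD' : Geo A T (f ++ e' ++ [c]) := by
    refine hD.congr ?_ hvD (by simp at hld ⊢; omega)
    rw [List.append_assoc, wordOver_append]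
    exact ⟨hf.1, hd'.1⟩
  have hle := h1.length_eq
  have hlf : (x' ++ (f ++ e')).length ≤ n := by
    simp only [List.length_append, List.length_singleton] at hle hn hld ⊢; omega
  have hx' : Good A x' := (hb.1.congr h1).left
  refine ⟨x ++ e', c, by simp, (H.extends_of_geo hT hlf hx' hr hD').congr h1'.symm, ?_⟩
  rcases hq with ⟨rfl, hu⟩ | ⟨T', v, g, g', hT', hr', hg, hg', hvg, hab, hu, hu'⟩
  · exact Or.inr ⟨T, x', f ++ e, f ++ e', hT, hr, hD, hD', hvD, hbc1, hu.trans h1, h1'⟩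
  by_cases hac : a.1 = c.1
  · obtain rfl : T' = T := hT'.eq_of_mem hT hab (hg.1 a (by simp)) (hg'.1 b (by simp))
      (by rwa [hac]) hbT
    obtain ⟨h2, h3⟩ := H.decomp_unique hT (by rw [← hu'.length_eq]; exact hn) (hb.1.congr hu')
      (hu'.symm.trans h1) hr' hr hg'.left hD.left
    have h4 : val A T' (g ++ [a]) = val A T' (f ++ e' ++ [c]) := by
      rw [hvg, val_append, h3, ← val_append, hvD]
    obtain rfl : a = c := by
      refine (eq_or_eq_linv hac).resolve_right fun h => ?_
      have hc : c = linv a := by rw [h, linv_linv]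
      rw [hc] at hD' h4
      exact hg.no_inverse_ends hT hD' h4
    refine Or.inl ⟨rfl, hu.trans (Eqv.trans ?_ h1'.symm)⟩
    exact (h2.append_right g).trans
      ((hg.left.eqv hT hD'.left (val_right_cancel h4)).append_left x')
  · exfalso
    obtain ⟨V, b₁, a₁, l, K, h2, h3, h4⟩ := hg'.two_ends hT' hl hab.symm hg hvg.symm
    obtain ⟨W, b₂, c₁, j, J, h5, h6, h7⟩ := hD.two_ends hT hl hbc1 hD' hvD
    refine H.no_mixed hl hn hb.1 (V := v ++ V) (W := x' ++ W) (a := b) (a' := b₁) (a'' := b₂)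
      (b := a₁) (c := c₁) (l := l) (j := j) (K := K) (J := J) ?_ ?_ h3 h6
      (by rw [h4]; exact hab.symm) (by rw [h7]; exact hbc1) (by rw [h4, h7]; exact hac)
    · rw [h2] at hu'
      simpa using hu'
    · rw [h5] at h1
      simpa using h1

theorem ctrl (n : ℕ) : Ctrl A n := by
  induction n with
  | zero => intro u a h; simp at h
  | succ n H =>
    intro u a hn hu w hw
    have hlen : ∀ u' b, Eqv A (u ++ [a]) (u' ++ [b]) → u'.length ≤ n := by
      intro u' b h
      have := h.length_eq
      simp only [List.length_append, List.length_singleton] at this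
      omega
    induction hw with
    | refl => exact ⟨u, a, rfl, hu, Or.inl ⟨rfl, Eqv.refl _⟩⟩
    | tail hw hs ih =>
      obtain ⟨u₁, b, rfl, hb, hq⟩ := ih
      exact H.swap_step hl (hlen u₁ b hw) hb hq hs

theorem good_snoc {u : Word S} {a : S × Bool} (h : Extends A u a) : Good A (u ++ [a]) :=
  (ctrl hl _).good_snoc u.length.lt_succ_self h

theorem eqv_cancel {u u' : Word S} {a : S × Bool} (h : Good A (u ++ [a]))
    (he : Eqv A (u ++ [a]) (u' ++ [a])) : Eqv A u u' :=
  (ctrl hl _).cancel_letter u.length.lt_succ_self h he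

theorem good_append {T : Set S} {v e : Word S} (hT : IsPair A T) (hg : Good A v)
    (hv : RedT A T v) (he : Geo A T e) : Good A (v ++ e) :=
  (ctrl hl _).good_append hT le_rfl hg hv he

end main

/-! ### The action on classes of good words -/

/-- The word `w'` is, up to equivalence, obtained from `w` by adding or cancelling the
letter `a`. -/
def Act (A : ArtinData S) (a : S × Bool) (w w' : Word S) : Prop :=
  Eqv A w' (w ++ [a]) ∨ Eqv A w (w' ++ [linv a])

/-- The equivalence of good words. -/
def goodSetoid (A : ArtinData S) : Setoid {w : Word S // Good A w} where
  r w w' := Eqv A w.1 w'.1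
  iseqv := ⟨fun _ => Eqv.refl _, fun h => h.symm, fun h h' => h.trans h'⟩

/-- Equivalence classes of good words. -/
abbrev GoodClass (A : ArtinData S) := Quotient (goodSetoid A)

/-- The class of a good word. -/
def Good.cls {A : ArtinData S} {w : Word S} (h : Good A w) : GoodClass A :=
  Quotient.mk (goodSetoid A) ⟨w, h⟩

/-- The action of a letter, as a relation on classes. -/
def ActC (A : ArtinData S) (a : S × Bool) (x y : GoodClass A) : Prop :=
  ∃ w w' : Word S, ∃ (hw : Good A w) (hw' : Good A w'), x = hw.cls ∧ y = hw'.cls ∧ Act A a w w'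

section action

variable {A : ArtinData S}

theorem cls_eq_iff {w w' : Word S} (hw : Good A w) (hw' : Good A w') :
    hw.cls = hw'.cls ↔ Eqv A w w' := Quotient.eq (r := goodSetoid A)

theorem exists_cls (x : GoodClass A) : ∃ w, ∃ hw : Good A w, x = hw.cls := by
  induction x using Quotient.inductionOn with
  | _ w => exact ⟨w.1, w.2, rfl⟩

theorem Act.symm {a : S × Bool} {w w' : Word S} (h : Act A a w w') : Act A (linv a) w' w := by
  rcases h with h | h
  · exact Or.inr (by rwa [linv_linv])
  · exact Or.inl h

theorem ActC.symm {a : S × Bool} {x y : GoodClass A} (h : ActC A a x y) :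
    ActC A (linv a) y x := by
  obtain ⟨w, w', hw, hw', hx, hy, h⟩ := h
  exact ⟨w', w, hw', hw, hy, hx, h.symm⟩

variable (hl : ∀ s t : S, s ≠ t → 3 ≤ A.m s t)
include hl

theorem exists_actC (a : S × Bool) (x : GoodClass A) : ∃ y, ActC A a x y := by
  obtain ⟨w, hw, rfl⟩ := exists_cls x
  by_cases h : Ends A w (linv a)
  · obtain ⟨u, hu⟩ := h
    have hg : Good A u := (hw.congr hu).left
    exact ⟨hg.cls, w, u, hw, hg, rfl, rfl, Or.inr hu⟩
  · have hg := good_snoc hl ⟨hw, h⟩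
    exact ⟨hg.cls, w, _, hw, hg, rfl, rfl, Or.inl (Eqv.refl _)⟩

theorem ActC.unique {a : S × Bool} {x y y' : GoodClass A} (h : ActC A a x y)
    (h' : ActC A a x y') : y = y' := by
  have key : ∀ {w w' v v' : Word S}, Good A v → Eqv A w v → Eqv A w' (w ++ [a]) →
      Eqv A v (v' ++ [linv a]) → Good A w' → False := by
    intro w w' v v' hv hwv h1 h2 hg
    have h3 : Eqv A w' (v' ++ [linv a] ++ [a]) :=
      h1.trans ((hwv.trans h2).append_right [a])
    exact hg _ h3 v' [] (linv a) (by simp)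
  obtain ⟨w, w', hw, hw', rfl, rfl, h⟩ := h
  obtain ⟨v, v', hv, hv', he, rfl, h'⟩ := h'
  rw [cls_eq_iff] at he
  rw [cls_eq_iff]
  rcases h with h | h <;> rcases h' with h' | h'
  · exact h.trans ((he.append_right [a]).trans h'.symm)
  · exact (key hv he h h' hw').elim
  · exact (key hw he.symm h' h hv').elim
  · exact eqv_cancel hl (hw.congr h) (h.symm.trans (he.trans h'))

/-- The action of a letter on classes of good words. -/
noncomputable def actFun (a : S × Bool) (x : GoodClass A) : GoodClass A :=
  (exists_actC hl a x).choose

theorem actFun_eq {a : S × Bool} {x y : GoodClass A} (h : ActC A a x y) : actFun hl a x = y :=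
  ActC.unique hl (exists_actC hl a x).choose_spec h

theorem actFun_linv (a : S × Bool) (x : GoodClass A) : actFun hl (linv a) (actFun hl a x) = x :=
  actFun_eq hl (exists_actC hl a x).choose_spec.symm

/-- The action of a generator, as a permutation. -/
noncomputable def actPerm (s : S) : Equiv.Perm (GoodClass A) where
  toFun := actFun hl (s, false)
  invFun := actFun hl (s, true)
  left_inv x := actFun_linv hl (s, false) x
  right_inv x := actFun_linv hl (s, true) x

/-- The action of a word on the right on classes of good words. -/
noncomputable def actWord (w : Word S) (x : GoodClass A) : GoodClass A :=
  w.foldl (fun y a => actFun hl a y) x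

theorem actWord_eq_lift (w : Word S) (x : GoodClass A) :
    actWord hl w x = (FreeGroup.lift (actPerm hl) (FreeGroup.mk w))⁻¹ x := by
  induction w generalizing x with
  | nil => simp [actWord]
  | cons a w ih =>
    have h1 : actWord hl (a :: w) x = actWord hl w (actFun hl a x) := rfl
    rw [h1, ih]
    simp only [FreeGroup.lift_mk, List.map_cons, List.prod_cons, mul_inv_rev, Equiv.Perm.mul_apply]
    congr 1
    obtain ⟨s, σ⟩ := a
    cases σ
    · simp only [cond_false, inv_inv]; rfl
    · rfl

theorem actWord_append_geo {T : Set S} (hT : IsPair A T) {v f g p : Word S} (hv : Good A v)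
    (hr : RedT A T v) (hf : Geo A T f) (hg : Geo A T g) (hp : WordOver T p)
    (h : val A T (f ++ p) = val A T g) :
    actWord hl p (good_append hl hT hv hr hf).cls = (good_append hl hT hv hr hg).cls := by
  induction p generalizing f with
  | nil =>
    simp only [List.append_nil] at h
    exact (cls_eq_iff _ _).2 ((hf.eqv hT hg h).append_left v)
  | cons c p ih =>
    have hp' := wordOver_append.1 (show WordOver T ([c] ++ p) from hp)
    have hc : c.1 ∈ T := wordOver_singleton.1 hp'.1
    obtain ⟨e, he, hve⟩ := exists_geo (A := A) (wordOver_append.2 ⟨hf.1, hp'.1⟩)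
    have hstep : actFun hl c (good_append hl hT hv hr hf).cls =
        (good_append hl hT hv hr he).cls := by
      refine actFun_eq hl ⟨_, _, _, _, rfl, rfl, ?_⟩
      rcases hf.snoc_or hc with h1 | ⟨e', h1, h2⟩
      · left
        rw [List.append_assoc]
        exact (he.eqv hT h1 hve).append_left v
      · right
        rw [List.append_assoc]
        have h3 : val A T e' = val A T e := by
          rw [hve, val_append, h2, ← val_append, val_linv_cancel]
        refine Eqv.append_left ?_ v
        exact (hf.eqv hT h1 h2).trans ((h1.left.eqv hT he h3).append_right [linv c])
    have h1 : actWord hl (c :: p) (good_append hl hT hv hr hf).cls =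
        actWord hl p (actFun hl c (good_append hl hT hv hr hf).cls) := rfl
    rw [h1, hstep]
    refine ih he hp'.2 ?_
    rw [val_append, hve, ← val_append, ← h]
    simp

theorem actWord_rel {u v : Word S} (h : IsRel A u v) (x : GoodClass A) :
    actWord hl u x = actWord hl v x := by
  obtain ⟨s, t, k, hst, hk, hu, hv⟩ := h
  have hT : IsPair A {s, t} := ⟨s, t, k, hst, rfl, hk⟩
  have hval : val A {s, t} u = val A {s, t} v :=
    IsRel.wbar_eq ⟨s, t, k, hst, on_pair_m hk, hu, hv⟩
  have hover : ∀ n, WordOver {s, t} (altWord s t n) ∧ WordOver {s, t} (altWord t s n) := by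
    intro n
    induction n with
    | zero => exact ⟨wordOver_nil, wordOver_nil⟩
    | succ n ih =>
      refine ⟨?_, ?_⟩
      · exact wordOver_append.2 ⟨wordOver_singleton.2 (by simp), ih.2⟩
      · exact wordOver_append.2 ⟨wordOver_singleton.2 (by simp), ih.1⟩
  have hou : WordOver {s, t} u := hu ▸ (hover k).1
  have hov : WordOver {s, t} v := hv ▸ (hover k).2
  obtain ⟨w, hw, rfl⟩ := exists_cls x
  obtain ⟨y, f, h1, h2, h3⟩ := hw.exists_decomp hT
  have hy : Good A y := (hw.congr h1).left
  obtain ⟨g, hg, hvg⟩ := exists_geo (A := A) (wordOver_append.2 ⟨h3.1, hou⟩)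
  rw [(cls_eq_iff hw (good_append hl hT hy h2 h3)).2 h1,
    actWord_append_geo hl hT hy h2 h3 hg hou hvg.symm,
    actWord_append_geo hl hT hy h2 h3 hg hov]
  rw [hvg, val_append, val_append, hval]

theorem actWord_eq {w w' : Word S} (h : wbar A w = wbar A w') (x : GoodClass A) :
    actWord hl w x = actWord hl w' x := by
  rw [actWord_eq_lift, actWord_eq_lift, lift_eq_of_wbar_eq (actPerm hl) (fun u v huv => ?_) h]
  rw [← inv_inj]
  ext1 y
  rw [← actWord_eq_lift, ← actWord_eq_lift, actWord_rel hl huv]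

theorem Geodesic.actWord_nil {w : Word S} (hw : Geodesic A w) :
    ∃ hg : Good A w, actWord hl w good_nil.cls = hg.cls := by
  induction w using List.reverseRecOn with
  | nil => exact ⟨good_nil, rfl⟩
  | append_singleton p c ih =>
    have hp : Geodesic A p := by
      intro w' hw'
      have := hw (w' ++ [c]) (by rw [wbar_append, wbar_append, hw'])
      simpa using this
    obtain ⟨hg, he⟩ := ih hp
    have hc : Extends A p c := by
      refine ⟨hg, ?_⟩
      rintro ⟨q, hq⟩
      have h1 := hq.length_eq
      have h2 := hw q (by
        rw [wbar_append A p, hq.rEq.wbar_eq, wbar_append, wbar_linv, inv_mul_cancel_right])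
      simp only [List.length_append, List.length_singleton] at h1 h2
      omega
    refine ⟨good_snoc hl hc, ?_⟩
    have h1 : actWord hl (p ++ [c]) good_nil.cls = actFun hl c (actWord hl p good_nil.cls) := by
      simp [actWord]
    rw [h1, he]
    exact actFun_eq hl ⟨p, _, hg, _, rfl, rfl, Or.inl (Eqv.refl _)⟩

theorem Geodesic.rEq {w w' : Word S} (hw : Geodesic A w) (hw' : Geodesic A w')
    (h : wbar A w = wbar A w') : REq A w w' := by
  obtain ⟨hg, h1⟩ := hw.actWord_nil hl
  obtain ⟨hg', h2⟩ := hw'.actWord_nil hl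
  rw [actWord_eq hl h, h2] at h1
  exact ((cls_eq_iff hg hg').1 h1.symm).rEq

end action

/-- Corollary 3.3: in an Artin–Tits group of large type, any two geodesic
words representing the same element are related by `→_{1,2}`. -/
theorem stmt19 {S : Type*} [Finite S] (A : ArtinData S)
    (hlarge : ∀ s t : S, s ≠ t → 3 ≤ A.m s t)
    (w w' : Word S) (hw : Geodesic A w) (hw' : Geodesic A w')
    (h : wbar A w = wbar A w') :
    Steps12 A w' w :=
  (hw.rEq hlarge hw' h).symm.steps12

end ArtinTits
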